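/- arXiv:1209.3882 — 7 statements merged into one kernel-verified Lean document; each statement's English description precedes it below -/
import Mathlib

section
/- Let n ≥ 2 and let S ⊆ M_n(ℂ) be an irreducible multiplicative semigroup of matrices, each of rank at most one, such that every member of S has nonnegative diagonal entries and such that the closure of ℝ₊S equals S. Then there exists an invertible diagonal matrix D ∈ M_n(ℂ) and subsets X, Y of ℝ₊^n, each of which spans ℂ^n, such that D S D⁻¹ = { x yᵀ : x ∈ X, y ∈ Y }. -/
open Matrix

/-- A matrix of rank at most one is an outer product. -/
theorem Matrix.exists_eq_vecMulVec_of_rank_le_one {m n K : Type*} [Fintype m] [Fintype n]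
    [DecidableEq n] [Field K] (A : Matrix m n K) (hA : A.rank ≤ 1) :
    ∃ (x : m → K) (y : n → K), A = vecMulVec x y := by
  obtain ⟨⟨x, _⟩, hx⟩ := finrank_le_one_iff.mp hA
  choose c hc using fun j : n => hx ⟨A *ᵥ Pi.single j 1, LinearMap.mem_range_self A.mulVecLin _⟩
  refine ⟨x, c, ?_⟩
  ext i j
  have h := congrFun (congrArg Subtype.val (hc j)) i
  simp only [SetLike.mk_smul_mk, Pi.smul_apply, smul_eq_mul, mulVec_single_one, col_apply] at h
  rw [vecMulVec_apply, ← h, mul_comm]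

/-- A set of vectors with trivial annihilator under the dot product spans. -/
theorem Submodule.span_eq_top_of_dotProduct {n K : Type*} [Fintype n] [DecidableEq n] [Field K]
    (T : Set (n → K)) (h : ∀ y : n → K, (∀ w ∈ T, y ⬝ᵥ w = 0) → y = 0) :
    Submodule.span K T = ⊤ := by
  by_contra hT
  obtain ⟨f, hf0, hf⟩ := Submodule.exists_le_ker_of_lt_top _ (lt_top_iff_ne_top.mpr hT)
  have hfw (w : n → K) : f w = (fun i => f fun j => if i = j then 1 else 0) ⬝ᵥ w := by
    rw [f.pi_apply_eq_sum_univ w]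
    simp [dotProduct, mul_comm]
  have h0 := h _ fun w hw => (hfw w).symm.trans (hf (Submodule.subset_span hw))
  refine hf0 (LinearMap.ext fun w => ?_)
  rw [hfw w, h0, zero_dotProduct, LinearMap.zero_apply]

/-- An irreducible semigroup of matrices separates pairs of nonzero vectors. -/
theorem eq_zero_or_eq_zero_of_dotProduct_mulVec {n K : Type*} [Fintype n] [Field K]
    (hn : 2 ≤ Fintype.card n) (S : Set (Matrix n n K))
    (hsemi : ∀ A ∈ S, ∀ B ∈ S, A * B ∈ S)
    (hirr : ∀ p : Submodule K (n → K), (∀ A ∈ S, ∀ v ∈ p, A *ᵥ v ∈ p) → p = ⊥ ∨ p = ⊤)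
    (x y : n → K) (h : ∀ C ∈ S, y ⬝ᵥ C *ᵥ x = 0) : x = 0 ∨ y = 0 := by
  have hmem (C : Matrix n n K) (hC : C ∈ S) :
      C *ᵥ x ∈ Submodule.span K ((fun C : Matrix n n K => C *ᵥ x) '' S) :=
    Submodule.subset_span ⟨C, hC, rfl⟩
  rcases hirr (Submodule.span K ((fun C : Matrix n n K => C *ᵥ x) '' S)) (by
    intro A hA v hv
    induction hv using Submodule.span_induction with
    | mem v hv =>
      obtain ⟨C, hC, rfl⟩ := hv
      simpa only [mulVec_mulVec] using hmem _ (hsemi A hA C hC)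
    | zero => simp
    | add v w _ _ hv hw => simpa only [mulVec_add] using add_mem hv hw
    | smul c v _ hv => simpa only [mulVec_smul] using Submodule.smul_mem _ c hv) with hp | hp
  · left
    have hC (C : Matrix n n K) (hC : C ∈ S) : C *ᵥ x = 0 := by simpa [hp] using hmem C hC
    rcases hirr (Submodule.span K {x}) (by
      intro A hA v hv
      obtain ⟨c, rfl⟩ := Submodule.mem_span_singleton.mp hv
      simp [mulVec_smul, hC A hA]) with hq | hq
    · simpa using hq
    · have h1 := finrank_span_le_card (R := K) ({x} : Set (n → K))
      rw [hq, finrank_top, Module.finrank_fintype_fun_eq_card, Set.toFinset_singleton,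
        Finset.card_singleton] at h1
      omega
  · right
    classical
    refine dotProduct_eq_zero y fun w => ?_
    have hw : w ∈ Submodule.span K ((fun C : Matrix n n K => C *ᵥ x) '' S) := hp ▸ trivial
    induction hw using Submodule.span_induction with
    | mem v hv =>
      obtain ⟨C, hC, rfl⟩ := hv
      exact h C hC
    | zero => simp
    | add v w _ _ hv hw => simp [hv, hw]
    | smul c v _ hv => simp [hv]

open scoped ComplexOrder in
/-- An irreducible semigroup of matrices of rank at most one, with nonnegative traces and closed
under multiplication by nonnegative scalars, consists of all the products of one of its columns
with one of its rows. -/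
theorem exists_mem_iff_eq_vecMulVec {n : Type*} [Fintype n] [DecidableEq n]
    (S : Set (Matrix n n ℂ)) (hsemi : ∀ A ∈ S, ∀ B ∈ S, A * B ∈ S)
    (hn : 2 ≤ Fintype.card n)
    (hirr : ∀ p : Submodule ℂ (n → ℂ), (∀ A ∈ S, ∀ v ∈ p, A *ᵥ v ∈ p) → p = ⊥ ∨ p = ⊤)
    (hrank : ∀ A ∈ S, A.rank ≤ 1) (htr : ∀ A ∈ S, 0 ≤ A.trace)
    (hsmul : ∀ c : ℂ, 0 ≤ c → ∀ A ∈ S, c • A ∈ S) :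
    ∃ x₀ y₀ : n → ℂ, x₀ ≠ 0 ∧ y₀ ≠ 0 ∧
      ∀ A, A ∈ S ↔ ∃ P ∈ S, ∃ Q ∈ S, A = vecMulVec (P *ᵥ x₀) (y₀ ᵥ* Q) := by
  have hsep (x y : n → ℂ) (hx : x ≠ 0) (hy : y ≠ 0) : ∃ C ∈ S, y ⬝ᵥ C *ᵥ x ≠ 0 := by
    by_contra! h
    exact (eq_zero_or_eq_zero_of_dotProduct_mulVec hn S hsemi hirr x y h).elim hx hy
  have : Nonempty n := Fintype.card_pos_iff.mp (by omega)
  obtain ⟨A, hA, hA0⟩ := hsep 1 1 one_ne_zero one_ne_zero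
  obtain ⟨x, y, rfl⟩ := A.exists_eq_vecMulVec_of_rank_le_one (hrank A hA)
  have hx : x ≠ 0 := by rintro rfl; simp at hA0
  have hy : y ≠ 0 := by rintro rfl; simp at hA0
  obtain ⟨C, hC, hCt⟩ := hsep x y hx hy
  have ht := htr _ (hsemi C hC _ hA)
  rw [mul_vecMulVec, trace_vecMulVec, dotProduct_comm] at ht
  have hE := hsmul _ (inv_nonneg.mpr ht) _ (hsemi C hC _ hA)
  rw [mul_vecMulVec, ← vecMulVec_smul] at hE
  have hx₀ : C *ᵥ x ≠ 0 := by intro h; simp [h] at hCt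
  have hy₀ : (y ⬝ᵥ C *ᵥ x)⁻¹ • y ≠ 0 := smul_ne_zero (inv_ne_zero hCt) hy
  generalize C *ᵥ x = x₀ at *
  generalize (y ⬝ᵥ x₀)⁻¹ • y = y₀ at *
  refine ⟨x₀, y₀, hx₀, hy₀, fun B => ⟨fun hB => ?_, ?_⟩⟩
  · by_cases hB0 : B = 0
    · subst hB0
      exact ⟨0, hB, 0, hB, by simp⟩
    obtain ⟨u, v, rfl⟩ := B.exists_eq_vecMulVec_of_rank_le_one (hrank B hB)
    have hu : u ≠ 0 := by rintro rfl; simp at hB0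
    have hv : v ≠ 0 := by rintro rfl; simp at hB0
    obtain ⟨P, hP, hPα⟩ := hsep x₀ v hx₀ hv
    obtain ⟨Q, hQ, hQβ⟩ := hsep u y₀ hu hy₀
    have hpos := htr _ (hsemi _ hQ _ (hsemi _ (hsemi _ hB _ hP) _ hE))
    have hpos : 0 ≤ (v ⬝ᵥ P *ᵥ x₀) * (y₀ ⬝ᵥ Q *ᵥ u) := by
      have key : Q * (vecMulVec u v * P * vecMulVec x₀ y₀) =
          (v ⬝ᵥ P *ᵥ x₀) • vecMulVec (Q *ᵥ u) y₀ := by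
        rw [mul_assoc, mul_vecMulVec P, vecMulVec_mul_vecMulVec, vecMulVec_smul, Matrix.mul_smul,
          mul_vecMulVec]
      rwa [key, trace_smul, trace_vecMulVec, dotProduct_comm _ y₀, smul_eq_mul] at hpos
    refine ⟨_, hsemi _ hB _ hP, _, hsmul _ (inv_nonneg.mpr hpos) _ (hsemi _ hQ _ hB), ?_⟩
    rw [vecMulVec_mul, vecMulVec_mulVec, mul_vecMulVec, vecMul_smul, vecMul_vecMulVec,
      ← dotProduct_mulVec]
    ext i j
    simp only [vecMulVec_apply, Pi.smul_apply, smul_eq_mul, MulOpposite.smul_eq_mul_unop,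
      MulOpposite.unop_op]
    field_simp
  · rintro ⟨P, hP, Q, hQ, rfl⟩
    simpa only [mul_vecMulVec, vecMulVec_mul] using hsemi _ (hsemi _ hP _ hE) _ hQ

open scoped ComplexOrder in
/-- An irreducible semigroup of rank-at-most-one complex matrices with
nonnegative diagonals, closed under homogenization and topological closure, is diagonally
similar to a set of the form `X Yᵀ` with `X, Y ⊆ ℝ₊ⁿ` spanning `ℂⁿ`. -/
theorem stmt_0 {n : ℕ} (hn : 2 ≤ n) (S : Set (Matrix (Fin n) (Fin n) ℂ))
    (hsemi : ∀ A ∈ S, ∀ B ∈ S, A * B ∈ S)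
    (hirr : ∀ p : Submodule ℂ (Fin n → ℂ),
      (∀ A ∈ S, ∀ v ∈ p, A.mulVec v ∈ p) → p = ⊥ ∨ p = ⊤)
    (hrank : ∀ A ∈ S, A.rank ≤ 1)
    (hdiag : ∀ A ∈ S, ∀ i, 0 ≤ (A i i).re ∧ (A i i).im = 0)
    (hclos : closure {M | ∃ r : ℝ, 0 ≤ r ∧ ∃ A ∈ S, M = (r : ℂ) • A} = S) :
    ∃ d : Fin n → ℂ, (∀ i, d i ≠ 0) ∧
      ∃ X Y : Set (Fin n → ℝ),
        (∀ x ∈ X, ∀ i, 0 ≤ x i) ∧ (∀ y ∈ Y, ∀ i, 0 ≤ y i) ∧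
        Submodule.span ℂ ((fun x : Fin n → ℝ => fun i => (x i : ℂ)) '' X) = ⊤ ∧
        Submodule.span ℂ ((fun y : Fin n → ℝ => fun i => (y i : ℂ)) '' Y) = ⊤ ∧
        (fun A => diagonal d * A * diagonal (fun i => (d i)⁻¹)) '' S =
          {M | ∃ x ∈ X, ∃ y ∈ Y,
            M = vecMulVec (fun i => (x i : ℂ)) (fun i => (y i : ℂ))} := by
  have hdiag' (A) (hA : A ∈ S) (i : Fin n) : 0 ≤ A i i :=
    Complex.nonneg_iff.mpr ⟨(hdiag A hA i).1, (hdiag A hA i).2.symm⟩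
  have hn' : 2 ≤ Fintype.card (Fin n) := by simpa using hn
  have hsep := eq_zero_or_eq_zero_of_dotProduct_mulVec hn' S hsemi hirr
  obtain ⟨x₀, y₀, hx₀, hy₀, hS⟩ := exists_mem_iff_eq_vecMulVec S hsemi hn' hirr hrank
    (fun A hA => Finset.sum_nonneg fun i _ => hdiag' A hA i) (by
      intro c hc A hA
      rw [← hclos]
      obtain ⟨hre, him⟩ := Complex.nonneg_iff.mp hc
      exact subset_closure ⟨c.re, hre, A, hA, by
        rw [show ((c.re : ℝ) : ℂ) = c from Complex.ext rfl him]⟩)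
  have hxy (P) (hP : P ∈ S) (Q) (hQ : Q ∈ S) (i : Fin n) :
      0 ≤ (P *ᵥ x₀) i * (y₀ ᵥ* Q) i := by
    simpa only [vecMulVec_apply] using hdiag' _ ((hS _).mpr ⟨P, hP, Q, hQ, rfl⟩) i
  have hQ (i : Fin n) : ∃ Q ∈ S, (y₀ ᵥ* Q) i ≠ 0 := by
    by_contra! h
    rcases hsep (Pi.single i 1) y₀ (fun C hC => by
      rw [dotProduct_mulVec, dotProduct_single_one, h C hC]) with h | h
    · simp at h
    · exact hy₀ h
  have hP (i : Fin n) : ∃ P ∈ S, (P *ᵥ x₀) i ≠ 0 := by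
    by_contra! h
    rcases hsep x₀ (Pi.single i 1) (fun C hC => by
      rw [single_one_dotProduct, h C hC]) with h | h
    · exact hx₀ h
    · simp at h
  choose Q hQS hQ0 using hQ
  choose P hPS hP0 using hP
  set d : Fin n → ℂ := fun i => (y₀ ᵥ* Q i) i
  have hX (A) (hA : A ∈ S) (i : Fin n) : 0 ≤ d i * (A *ᵥ x₀) i := by
    rw [mul_comm]
    exact hxy A hA _ (hQS i) i
  have hY (A) (hA : A ∈ S) (i : Fin n) : 0 ≤ (y₀ ᵥ* A) i * (d i)⁻¹ := by
    have h : (y₀ ᵥ* A) i * (d i)⁻¹ =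
        ((P i *ᵥ x₀) i * (y₀ ᵥ* A) i) * (d i * (P i *ᵥ x₀) i)⁻¹ := by
      have h1 := hP0 i
      have h2 : d i ≠ 0 := hQ0 i
      field_simp
    rw [h]
    exact mul_nonneg (hxy _ (hPS i) A hA i) (inv_nonneg.mpr (hX _ (hPS i) i))
  have hre {z : ℂ} (hz : 0 ≤ z) : ((z.re : ℝ) : ℂ) = z :=
    Complex.ext rfl (Complex.nonneg_iff.mp hz).2
  refine ⟨d, hQ0, (fun A i => (d i * (A *ᵥ x₀) i).re) '' S,
    (fun A i => ((y₀ ᵥ* A) i * (d i)⁻¹).re) '' S, ?_, ?_, ?_, ?_, ?_⟩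
  · rintro _ ⟨A, hA, rfl⟩ i
    exact (Complex.nonneg_iff.mp (hX A hA i)).1
  · rintro _ ⟨A, hA, rfl⟩ i
    exact (Complex.nonneg_iff.mp (hY A hA i)).1
  · refine Submodule.span_eq_top_of_dotProduct _ fun w hw => ?_
    rcases hsep x₀ (fun i => w i * d i) (fun C hC => by
      rw [← hw _ ⟨_, ⟨C, hC, rfl⟩, rfl⟩]
      simp only [dotProduct, hre (hX C hC _), mul_assoc]) with h | h
    · exact absurd h hx₀
    · exact funext fun i => (mul_eq_zero.mp (congrFun h i)).resolve_right (hQ0 i)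
  · refine Submodule.span_eq_top_of_dotProduct _ fun w hw => ?_
    rcases hsep (fun i => (d i)⁻¹ * w i) y₀ (fun C hC => by
      rw [← hw _ ⟨_, ⟨C, hC, rfl⟩, rfl⟩, dotProduct_mulVec, dotProduct_comm w]
      simp only [dotProduct, hre (hY C hC _), mul_assoc]) with h | h
    · exact funext fun i => (mul_eq_zero.mp (congrFun h i)).resolve_left (inv_ne_zero (hQ0 i))
    · exact absurd h hy₀
  · have hconj (A B : Matrix (Fin n) (Fin n) ℂ) (hA : A ∈ S) (hB : B ∈ S) :
        diagonal d * vecMulVec (A *ᵥ x₀) (y₀ ᵥ* B) * diagonal (fun i => (d i)⁻¹) =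
          vecMulVec (fun i => (((d i * (A *ᵥ x₀) i).re : ℝ) : ℂ))
            (fun i => ((((y₀ ᵥ* B) i * (d i)⁻¹).re : ℝ) : ℂ)) := by
      ext i j
      rw [mul_diagonal, diagonal_mul, vecMulVec_apply, vecMulVec_apply, hre (hX A hA i),
        hre (hY B hB j)]
      ring
    ext M
    constructor
    · rintro ⟨A, hA, rfl⟩
      obtain ⟨B, hB, C, hC, rfl⟩ := (hS A).mp hA
      exact ⟨_, ⟨B, hB, rfl⟩, _, ⟨C, hC, rfl⟩, hconj B C hB hC⟩
    · rintro ⟨_, ⟨B, hB, rfl⟩, _, ⟨C, hC, rfl⟩, rfl⟩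
      exact ⟨_, (hS _).mpr ⟨B, hB, C, hC, rfl⟩, hconj B C hB hC⟩
end

section
/- Let n ≥ 2 and let S ⊆ M_n(ℂ) be an irreducible multiplicative semigroup of matrices such that the closure of ℝ₊S equals S. Suppose there exists a nonzero linear functional φ : M_n(ℂ) → ℂ such that φ(A) is a nonnegative real number for every A ∈ S. Then S contains a matrix of rank exactly one. -/
open Matrix

section Burnside

variable {k V : Type*} [Field k] [IsAlgClosed k] [AddCommGroup V] [Module k V]
  [FiniteDimensional k V] [Nontrivial V]

/-- **Burnside's theorem** on irreducible algebras of endomorphisms. -/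
theorem Subalgebra.eq_top_of_forall_invariant (A : Subalgebra k (Module.End k V))
    (h : ∀ p : Submodule k V, (∀ f ∈ A, ∀ v ∈ p, f v ∈ p) → p = ⊥ ∨ p = ⊤) : A = ⊤ := by
  have hsimple : IsSimpleModule A V := by
    refine { toIsSimpleOrder := { eq_bot_or_eq_top := fun q => ?_ } }
    have := h (q.restrictScalars k) fun f hf v hv => q.smul_mem (⟨f, hf⟩ : A) hv
    simpa [Submodule.restrictScalars_eq_bot_iff, Submodule.restrictScalars_eq_top_iff] using this
  refine eq_top_iff.2 fun f _ => ?_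
  have hschur := (IsSimpleModule.algebraMap_end_bijective_of_isAlgClosed (A := A) (V := V) k).2
  let F : Module.End (Module.End A V) V :=
    { toFun := f
      map_add' := f.map_add
      map_smul' := fun g v => by
        obtain ⟨c, rfl⟩ := hschur g
        simp }
  classical
  let b := Module.finBasis k V
  obtain ⟨r, hr⟩ := jacobson_density (R := A) F (Finset.univ.image b)
  have : f = r := b.ext fun i => hr (b i) (by simp)
  exact this ▸ r.2

end Burnside

/-- A nonzero subspace of matrices stable under left and right multiplication is everything. -/
theorem Matrix.eq_top_of_mul_mem {m K : Type*} [Fintype m] [DecidableEq m] [Field K]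
    (L : Submodule K (Matrix m m K)) (hl : ∀ X, ∀ Y ∈ L, X * Y ∈ L) (hr : ∀ X, ∀ Y ∈ L, Y * X ∈ L)
    (h0 : L ≠ ⊥) : L = ⊤ := by
  obtain ⟨Y, hY, hY0⟩ := L.ne_bot_iff.1 h0
  obtain ⟨i, j, hij⟩ : ∃ i j, Y i j ≠ 0 := by
    by_contra! h
    exact hY0 (Matrix.ext h)
  have hone : (1 : Matrix m m K) ∈ L := by
    rw [← Matrix.diagonal_one, ← Matrix.sum_single_eq_diagonal]
    refine L.sum_mem fun a _ => ?_
    have := L.smul_mem (Y i j)⁻¹ (hr (single j a 1) _ (hl (single a i 1) Y hY))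
    rw [Matrix.single_mul_mul_single] at this
    simpa [hij, Matrix.smul_single] using this
  exact eq_top_iff.2 fun X _ => by simpa using hl X 1 hone

/-- The linear span of an irreducible semigroup of matrices is the full matrix algebra. -/
theorem Matrix.span_eq_top_of_irreducible {m K : Type*} [Fintype m] [DecidableEq m] [Nontrivial m]
    [Field K] [IsAlgClosed K] (S : Set (Matrix m m K))
    (hsemi : ∀ A ∈ S, ∀ B ∈ S, A * B ∈ S)
    (hirr : ∀ p : Submodule K (m → K), (∀ A ∈ S, ∀ v ∈ p, A.mulVec v ∈ p) → p = ⊥ ∨ p = ⊤) :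
    Submodule.span K S = ⊤ := by
  have hadj : Algebra.adjoin K S = ⊤ := by
    have hmap : (Algebra.adjoin K S).map (Matrix.toLinAlgEquiv' (R := K) (n := m)).toAlgHom = ⊤ := by
      refine Subalgebra.eq_top_of_forall_invariant _ fun p hp => hirr p fun A hA v hv => ?_
      exact hp (toLinAlgEquiv' A) ⟨A, Algebra.subset_adjoin hA, rfl⟩ v hv
    refine eq_top_iff.2 fun X _ => ?_
    obtain ⟨Y, hY, hYX⟩ : toLinAlgEquiv' X ∈ (Algebra.adjoin K S).map
      (Matrix.toLinAlgEquiv' (R := K) (n := m)).toAlgHom := hmap ▸ Algebra.mem_top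
    exact (toLinAlgEquiv'.injective hYX : Y = X) ▸ hY
  have hll : ∀ X ∈ S, ∀ Y ∈ Submodule.span K S, X * Y ∈ Submodule.span K S := fun X hX Y hY => by
    induction hY using Submodule.span_induction with
    | mem Y hY => exact Submodule.subset_span (hsemi X hX Y hY)
    | zero => simp
    | add Y Z _ _ hY hZ => rw [mul_add]; exact add_mem hY hZ
    | smul c Y _ hY => rw [Matrix.mul_smul]; exact Submodule.smul_mem _ _ hY
  have hrr : ∀ X ∈ S, ∀ Y ∈ Submodule.span K S, Y * X ∈ Submodule.span K S := fun X hX Y hY => by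
    induction hY using Submodule.span_induction with
    | mem Y hY => exact Submodule.subset_span (hsemi Y hY X hX)
    | zero => simp
    | add Y Z _ _ hY hZ => rw [add_mul]; exact add_mem hY hZ
    | smul c Y _ hY => rw [Matrix.smul_mul]; exact Submodule.smul_mem _ _ hY
  refine eq_top_of_mul_mem _ (fun X => ?_) (fun X => ?_) fun hbot => ?_
  · have hX : X ∈ Algebra.adjoin K S := hadj ▸ Algebra.mem_top
    induction hX using Algebra.adjoin_induction with
    | mem X hX => exact hll X hX
    | algebraMap c =>
      intro Y hY
      rw [← Algebra.smul_def]
      exact Submodule.smul_mem _ _ hY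
    | add X Z _ _ hX hZ => intro Y hY; rw [add_mul]; exact add_mem (hX Y hY) (hZ Y hY)
    | mul X Z _ _ hX hZ => intro Y hY; rw [mul_assoc]; exact hX _ (hZ Y hY)
  · have hX : X ∈ Algebra.adjoin K S := hadj ▸ Algebra.mem_top
    induction hX using Algebra.adjoin_induction with
    | mem X hX => exact hrr X hX
    | algebraMap c =>
      intro Y hY
      rw [← Algebra.commutes, ← Algebra.smul_def]
      exact Submodule.smul_mem _ _ hY
    | add X Z _ _ hX hZ => intro Y hY; rw [mul_add]; exact add_mem (hX Y hY) (hZ Y hY)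
    | mul X Z _ _ hX hZ => intro Y hY; rw [← mul_assoc]; exact hZ _ (hX Y hY)
  · have hzero : ∀ A ∈ S, A = 0 := Submodule.span_eq_bot.1 hbot
    obtain ⟨i, j, hij⟩ := exists_pair_ne m
    rcases hirr (K ∙ (Pi.single i 1 : m → K)) (fun A hA v _ => by simp [hzero A hA]) with h | h
    · simp at h
    · have hmem : (Pi.single j 1 : m → K) ∈ K ∙ (Pi.single i 1 : m → K) := h ▸ Submodule.mem_top
      obtain ⟨c, hc⟩ := Submodule.mem_span_singleton.1 hmem
      simpa [hij, hij.symm] using congrFun hc j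

open scoped Matrix.Norms.Elementwise

/-- In a closed cone of matrices whose nonzero members are invertible, those with determinant of
modulus one form a compact set. -/
theorem Matrix.isCompact_norm_det_eq_one {ι : Type*} [Fintype ι] [DecidableEq ι] [Nonempty ι]
    {T : Set (Matrix ι ι ℂ)} (hclosed : IsClosed T)
    (hsmul : ∀ c : ℝ, 0 ≤ c → ∀ Z ∈ T, (c : ℂ) • Z ∈ T) (hunit : ∀ Z ∈ T, Z ≠ 0 → Z.det ≠ 0) :
    IsCompact {Z ∈ T | ‖Z.det‖ = 1} := by
  have hdet : Continuous fun Z : Matrix ι ι ℂ => ‖Z.det‖ := by fun_prop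
  have hK : IsCompact (T ∩ Metric.sphere 0 1) := (isCompact_sphere 0 1).inter_left hclosed
  refine Metric.isCompact_of_isClosed_isBounded
    (hclosed.inter (isClosed_eq hdet continuous_const)) ?_
  rcases (T ∩ Metric.sphere 0 1).eq_empty_or_nonempty with hE | hne
  · refine Bornology.IsBounded.subset (t := {0}) Bornology.isBounded_singleton fun Z hZ => ?_
    by_contra hZ0
    have hZ0 : ‖Z‖ ≠ 0 := norm_ne_zero_iff.2 hZ0
    refine hE.le ⟨hsmul ‖Z‖⁻¹ (by positivity) Z hZ.1, ?_⟩
    simp [norm_smul, hZ0]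
  obtain ⟨Y, hY, hmin⟩ := hK.exists_isMinOn hne hdet.continuousOn
  have hYm : 0 < ‖Y.det‖ := norm_pos_iff.2 <| hunit Y hY.1 <| by
    rintro rfl; simpa using hY.2
  refine isBounded_iff_forall_norm_le.2 ⟨max 1 (‖Y.det‖⁻¹), fun Z hZ => ?_⟩
  by_contra! hlt
  obtain ⟨h1, h2⟩ := max_lt_iff.1 hlt
  have hpos : 0 < ‖Z‖ := by linarith
  have hmem : ((‖Z‖⁻¹ : ℝ) : ℂ) • Z ∈ T ∩ Metric.sphere 0 1 := by
    refine ⟨hsmul _ (by positivity) Z hZ.1, ?_⟩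
    simp [norm_smul, hpos.ne']
  have hle : ‖Y.det‖ ≤ ‖(((‖Z‖⁻¹ : ℝ) : ℂ) • Z).det‖ := hmin hmem
  rw [det_smul, norm_mul, hZ.2, mul_one, norm_pow, Complex.norm_real, norm_inv, norm_norm,
    inv_pow] at hle
  have h3 : ‖Z‖ ≤ ‖Z‖ ^ Fintype.card ι := le_self_pow₀ h1.le Fintype.card_ne_zero
  have h4 : (‖Z‖ ^ Fintype.card ι)⁻¹ ≤ ‖Z‖⁻¹ := inv_anti₀ hpos h3
  have h5 : ‖Z‖⁻¹ < ‖Y.det‖ := inv_lt_of_inv_lt₀ hYm h2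
  linarith

theorem Matrix.sum_norm_sq_midpoint_lt {ι κ : Type*} [Fintype ι] [Fintype κ] {X Y : Matrix ι κ ℂ}
    (h : X ≠ Y) : ∑ i, ∑ j, ‖((2⁻¹ : ℝ) • (X + Y)) i j‖ ^ 2 <
      2⁻¹ * (∑ i, ∑ j, ‖X i j‖ ^ 2 + ∑ i, ∑ j, ‖Y i j‖ ^ 2) := by
  have key (a b : ℂ) : ‖(2⁻¹ : ℝ) • (a + b)‖ ^ 2 + ‖(2⁻¹ : ℝ) • (a - b)‖ ^ 2
      = 2⁻¹ * (‖a‖ ^ 2 + ‖b‖ ^ 2) := by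
    have := parallelogram_law_with_norm ℝ a b
    simp only [norm_smul, Real.norm_eq_abs]
    rw [abs_of_pos (by norm_num)]
    linarith
  have hsum : 2⁻¹ * (∑ i, ∑ j, ‖X i j‖ ^ 2 + ∑ i, ∑ j, ‖Y i j‖ ^ 2) =
      ∑ i, ∑ j, ‖((2⁻¹ : ℝ) • (X + Y)) i j‖ ^ 2 + ∑ i, ∑ j, ‖((2⁻¹ : ℝ) • (X - Y)) i j‖ ^ 2 := by
    simp only [← Finset.sum_add_distrib, Finset.mul_sum]
    exact Finset.sum_congr rfl fun i _ => Finset.sum_congr rfl fun j _ => (key _ _).symm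
  have hpos : 0 < ∑ i, ∑ j, ‖((2⁻¹ : ℝ) • (X - Y)) i j‖ ^ 2 := by
    obtain ⟨i, j, hij⟩ : ∃ i j, X i j ≠ Y i j := by
      by_contra! h'
      exact h (Matrix.ext h')
    refine Finset.sum_pos' (fun _ _ => by positivity) ⟨i, Finset.mem_univ _, ?_⟩
    refine Finset.sum_pos' (fun _ _ => by positivity) ⟨j, Finset.mem_univ _, ?_⟩
    have : X i j - Y i j ≠ 0 := sub_ne_zero.2 hij
    rw [smul_apply, sub_apply]
    exact pow_pos (norm_pos_iff.2 (smul_ne_zero (by norm_num) this)) 2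
  linarith

/-- A compact semigroup of invertible matrices acting by left multiplication has a fixed point in
its closed convex hull. -/
theorem Matrix.exists_fixed_mem_closure_convexHull {ι : Type*} [Fintype ι] [DecidableEq ι]
    {G : Set (Matrix ι ι ℂ)} (hG : IsCompact G) (hne : G.Nonempty)
    (hmul : ∀ g ∈ G, ∀ h ∈ G, g * h ∈ G) (hunit : ∀ g ∈ G, IsUnit g) :
    ∃ P ∈ closure (convexHull ℝ G), ∀ h ∈ G, h * P = P := by
  set K := closure (convexHull ℝ G)
  have hKc : IsCompact K := (isBounded_convexHull.2 hG.isBounded).isCompact_closure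
  have hKconv : Convex ℝ K := (convex_convexHull ℝ G).closure
  have hGK : G ⊆ K := (subset_convexHull ℝ G).trans subset_closure
  have hact : ∀ h ∈ G, ∀ X ∈ K, h * X ∈ K := by
    intro h hh
    have hclosed : IsClosed {X | h * X ∈ K} :=
      isClosed_closure.preimage (continuous_const.matrix_mul continuous_id)
    have hconv : Convex ℝ {X | h * X ∈ K} := hKconv.linear_preimage (LinearMap.mulLeft ℝ h)
    exact closure_minimal (convexHull_min (fun g hg => hGK (hmul h hh g hg)) hconv) hclosed
  let q : Matrix ι ι ℂ → ℝ := fun X => ∑ i, ∑ j, ‖X i j‖ ^ 2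
  have hq : Continuous q := by
    refine continuous_finsetSum _ fun i _ => continuous_finsetSum _ fun j _ => ?_
    exact ((continuous_id.matrix_elem i j).norm).pow 2
  have hqg (X : Matrix ι ι ℂ) : Continuous fun g => q (g * X) :=
    hq.comp (continuous_id.matrix_mul continuous_const)
  let N : Matrix ι ι ℂ → ℝ := fun X => sSup ((fun g => q (g * X)) '' G)
  have hN : Continuous N :=
    hG.continuous_sSup (f := fun X g => q (g * X))
      (hq.comp (continuous_snd.matrix_mul continuous_fst))
  have hle (X : Matrix ι ι ℂ) {g} (hg : g ∈ G) : q (g * X) ≤ N X :=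
    le_csSup (hG.image (hqg X)).bddAbove ⟨g, hg, rfl⟩
  obtain ⟨P, hP, hmin⟩ := hKc.exists_isMinOn (hne.mono hGK) hN.continuousOn
  refine ⟨P, hP, fun h hh => ?_⟩
  by_contra hPh
  have hNh : N (h * P) ≤ N P := by
    refine csSup_le (hne.image _) ?_
    rintro _ ⟨g, hg, rfl⟩
    simpa [mul_assoc] using hle P (hmul g hg h hh)
  have hmid : (2⁻¹ : ℝ) • (h * P + P) ∈ K := by
    rw [smul_add]
    exact hKconv (hact h hh P hP) hP (by norm_num) (by norm_num) (by norm_num)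
  have hNmid := hmin hmid
  obtain ⟨g, hg, hgmax⟩ := hG.exists_isMaxOn hne (hqg ((2⁻¹ : ℝ) • (h * P + P))).continuousOn
  have hNg : N ((2⁻¹ : ℝ) • (h * P + P)) ≤ q (g * ((2⁻¹ : ℝ) • (h * P + P))) := by
    refine csSup_le (hne.image _) ?_
    rintro _ ⟨g', hg', rfl⟩
    exact hgmax hg'
  have hlt := sum_norm_sq_midpoint_lt fun h' : g * (h * P) = g * P =>
    hPh ((hunit g hg).mul_left_cancel h')
  rw [← mul_add, ← Matrix.mul_smul] at hlt
  have h1 := hle (h * P) hg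
  have h2 := hle P hg
  change q _ < 2⁻¹ * (q _ + q _) at hlt
  change N P ≤ N _ at hNmid
  linarith

/-- A closed cone of matrices that is a semigroup, spans the matrix algebra and has only invertible
nonzero members carries a nonzero nonnegative functional only in dimension at most one. -/
theorem Matrix.card_le_one_of_nonneg_functional {ι : Type*} [Fintype ι] [DecidableEq ι]
    {T : Set (Matrix ι ι ℂ)} (hclosed : IsClosed T)
    (hsmul : ∀ c : ℝ, 0 ≤ c → ∀ Z ∈ T, (c : ℂ) • Z ∈ T)
    (hmul : ∀ g ∈ T, ∀ h ∈ T, g * h ∈ T)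
    (hunit : ∀ Z ∈ T, Z ≠ 0 → Z.det ≠ 0) (hspan : Submodule.span ℂ T = ⊤)
    (ψ : Matrix ι ι ℂ →ₗ[ℂ] ℂ) (hψ : ψ ≠ 0) (hpos : ∀ Z ∈ T, 0 ≤ (ψ Z).re ∧ (ψ Z).im = 0) :
    Fintype.card ι ≤ 1 := by
  rw [← not_lt, Fintype.one_lt_card_iff_nontrivial]
  intro hι
  set G := {Z ∈ T | ‖Z.det‖ = 1}
  have hscale : ∀ Z ∈ T, Z ≠ 0 → ∃ c : ℂ, ∃ g ∈ G, Z = c • g := by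
    intro Z hZ hZ0
    have hd : 0 < ‖Z.det‖ := norm_pos_iff.2 (hunit Z hZ hZ0)
    let c : ℝ := ‖Z.det‖ ^ (-(Fintype.card ι : ℝ)⁻¹)
    have hc : 0 < c := Real.rpow_pos_of_pos hd _
    refine ⟨(c : ℂ)⁻¹, (c : ℂ) • Z, ⟨hsmul c hc.le Z hZ, ?_⟩, ?_⟩
    · have hcard : (Fintype.card ι : ℝ) ≠ 0 := by positivity
      rw [det_smul, norm_mul, norm_pow, Complex.norm_real, Real.norm_of_nonneg hc.le,
        ← Real.rpow_natCast, ← Real.rpow_mul hd.le, neg_mul, inv_mul_cancel₀ hcard,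
        Real.rpow_neg_one, inv_mul_cancel₀ hd.ne']
    · rw [smul_smul, inv_mul_cancel₀ (by exact_mod_cast hc.ne'), one_smul]
  have hG : IsCompact G := isCompact_norm_det_eq_one hclosed hsmul hunit
  have hGu : ∀ g ∈ G, IsUnit g := fun g hg => by
    rw [isUnit_iff_isUnit_det, isUnit_iff_ne_zero, ← norm_ne_zero_iff, hg.2]
    exact one_ne_zero
  have hne : G.Nonempty := by
    by_contra! hE
    refine hψ (LinearMap.ext_on hspan fun Z hZ => ?_)
    by_cases hZ0 : Z = 0
    · simp [hZ0]
    · obtain ⟨c, g, hg, -⟩ := hscale Z hZ hZ0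
      exact (hE.le hg).elim
  obtain ⟨P, hP, hfix⟩ := exists_fixed_mem_closure_convexHull hG hne
    (fun g hg h hh => ⟨hmul g hg.1 h hh.1, by rw [det_mul, norm_mul, hg.2, hh.2, one_mul]⟩) hGu
  have hscalar (Z : Matrix ι ι ℂ) : ∃ c : ℂ, Z * P = c • P := by
    have hZ : Z ∈ Submodule.span ℂ T := hspan ▸ Submodule.mem_top
    induction hZ using Submodule.span_induction with
    | mem Z hZ =>
      by_cases hZ0 : Z = 0
      · exact ⟨0, by simp [hZ0]⟩
      · obtain ⟨c, g, hg, rfl⟩ := hscale Z hZ hZ0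
        exact ⟨c, by rw [Matrix.smul_mul, hfix g hg]⟩
    | zero => exact ⟨0, by simp⟩
    | add X Y _ _ hX hY =>
      obtain ⟨a, ha⟩ := hX
      obtain ⟨b, hb⟩ := hY
      exact ⟨a + b, by rw [add_mul, ha, hb, add_smul]⟩
    | smul c X _ hX =>
      obtain ⟨a, ha⟩ := hX
      exact ⟨c * a, by rw [Matrix.smul_mul, ha, smul_smul]⟩
  have hP0 : P = 0 := by
    ext i j
    obtain ⟨l, hl⟩ := exists_ne i
    obtain ⟨c, hc⟩ := hscalar (single l i 1)
    have h1 := congrFun₂ hc i j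
    have h2 := congrFun₂ hc l j
    rw [single_mul_apply_of_ne _ _ _ _ _ hl.symm] at h1
    rw [single_mul_apply_same] at h2
    simp only [smul_apply, smul_eq_mul, one_mul] at h1 h2
    rcases zero_eq_mul.1 h1 with h | h
    · simpa [h] using h2
    · exact h
  obtain ⟨f, hfT, hf, -⟩ := Submodule.exists_fun_fin_finrank_span_eq ℂ T
  let F : Matrix ι ι ℂ →ₗ[ℝ] ℝ :=
    ∑ i, Complex.reLm ∘ₗ ψ.restrictScalars ℝ ∘ₗ LinearMap.mulLeft ℝ (f i)
  have hF (X : Matrix ι ι ℂ) : F X = ∑ i, (ψ (f i * X)).re := by simp [F]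
  have hFc : Continuous F := F.continuous_of_finiteDimensional
  have hFpos : ∀ g ∈ G, 0 < F g := by
    intro g hg
    have hnn : ∀ i ∈ Finset.univ, 0 ≤ (ψ (f i * g)).re :=
      fun i _ => (hpos _ (hmul _ (hfT i) _ hg.1)).1
    rw [hF]
    refine (Finset.sum_nonneg hnn).lt_of_ne' fun h0 => hψ ?_
    have hz := (Finset.sum_eq_zero_iff_of_nonneg hnn).1 h0
    have hcomp : ψ ∘ₗ LinearMap.mulRight ℂ g = 0 := by
      refine LinearMap.ext_on_range (hf.trans hspan) fun i => ?_
      exact Complex.ext (hz i (Finset.mem_univ i)) (hpos _ (hmul _ (hfT i) _ hg.1)).2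
    obtain ⟨u, rfl⟩ := hGu g hg
    ext1 X
    simpa [mul_assoc] using LinearMap.congr_fun hcomp (X * (↑u⁻¹ : Matrix ι ι ℂ))
  obtain ⟨g, hg, hgmin⟩ := hG.exists_isMinOn hne hFc.continuousOn
  have hsub : closure (convexHull ℝ G) ⊆ {X | F g ≤ F X} :=
    closure_minimal (convexHull_min (fun x hx => hgmin hx) (convex_halfSpace_ge F.isLinear _))
      (isClosed_le continuous_const hFc)
  have := hsub hP
  simp only [hP0, Set.mem_ofPred_eq, map_zero] at this
  exact (hFpos g hg).not_ge this

/-- Every square matrix factors through a space of dimension equal to its rank. -/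
theorem Matrix.exists_rank_factorization {m K : Type*} [Fintype m] [DecidableEq m] [Field K]
    (A : Matrix m m K) {r : ℕ} (hr : A.rank = r) :
    ∃ (P : Matrix m (Fin r) K) (Q : Matrix (Fin r) m K), A = P * Q := by
  subst hr
  obtain ⟨V, U, e, hV, hU, h⟩ := exists_rank_normal_form A
  obtain ⟨V, rfl⟩ := hV
  obtain ⟨U, rfl⟩ := hU
  let P₀ : Matrix m (Fin A.rank) K :=
    (fromRows 1 0 : Matrix (Fin A.rank ⊕ Fin (Fintype.card m - A.rank)) _ K).submatrix e id
  let Q₀ : Matrix (Fin A.rank) m K :=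
    (fromCols 1 0 : Matrix _ (Fin A.rank ⊕ Fin (Fintype.card m - A.rank)) K).submatrix id e
  have h' : P₀ * Q₀ = (V : Matrix m m K) * A * (U : Matrix m m K) := by
    rw [h]
    refine (submatrix_mul_equiv _ _ e (Equiv.refl _) e).trans ?_
    rw [fromRows_mul_fromCols]
    simp
  refine ⟨(↑V⁻¹ : Matrix m m K) * P₀, Q₀ * (↑U⁻¹ : Matrix m m K), ?_⟩
  rw [Matrix.mul_assoc, ← Matrix.mul_assoc P₀, h']
  simp [mul_assoc]

/-- If an irreducible, homogenization-closed and topologically closed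
semigroup of complex matrices admits a nonzero linear functional taking nonnegative real
values on it, then the semigroup contains a matrix of rank exactly one. -/
theorem stmt_1 {n : ℕ} (hn : 2 ≤ n) (S : Set (Matrix (Fin n) (Fin n) ℂ))
    (hsemi : ∀ A ∈ S, ∀ B ∈ S, A * B ∈ S)
    (hirr : ∀ p : Submodule ℂ (Fin n → ℂ),
      (∀ A ∈ S, ∀ v ∈ p, A.mulVec v ∈ p) → p = ⊥ ∨ p = ⊤)
    (hclos : closure {M | ∃ r : ℝ, 0 ≤ r ∧ ∃ A ∈ S, M = (r : ℂ) • A} = S)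
    (φ : Matrix (Fin n) (Fin n) ℂ →ₗ[ℂ] ℂ) (hφ : φ ≠ 0)
    (hpos : ∀ A ∈ S, 0 ≤ (φ A).re ∧ (φ A).im = 0) :
    ∃ A ∈ S, A.rank = 1 := by
  have : Nontrivial (Fin n) := Fin.nontrivial_iff_two_le.2 hn
  have hspan : Submodule.span ℂ S = ⊤ := span_eq_top_of_irreducible S hsemi hirr
  have hclosed : IsClosed S := hclos ▸ isClosed_closure
  have hsmul : ∀ c : ℝ, 0 ≤ c → ∀ A ∈ S, (c : ℂ) • A ∈ S := fun c hc A hA =>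
    hclos.subset (subset_closure ⟨c, hc, A, hA, rfl⟩)
  -- a nonzero member of minimal rank with nonzero square
  have hex : ∃ A ∈ S, A ≠ 0 := by
    by_contra! h
    exact hφ (LinearMap.ext_on hspan fun A hA => by simp [h A hA])
  obtain ⟨A₀, ⟨hA₀, hA₀0⟩, hmin₀⟩ :=
    exists_minimalFor_of_wellFoundedLT (fun A => A ∈ S ∧ A ≠ 0) Matrix.rank hex
  have hmin : ∀ B ∈ S, B ≠ 0 → A₀.rank ≤ B.rank := fun B hB hB0 =>
    (le_total A₀.rank B.rank).elim id fun h => hmin₀ ⟨hB, hB0⟩ h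
  obtain ⟨B, hB, htr⟩ : ∃ B ∈ S, (A₀ * B).trace ≠ 0 := by
    by_contra! h
    refine hA₀0 (ext_iff_trace_mul_right.2 fun X => ?_)
    have : traceLinearMap (Fin n) ℂ ℂ ∘ₗ LinearMap.mulLeft ℂ A₀ = 0 :=
      LinearMap.ext_on hspan fun X hX => h X hX
    simpa using LinearMap.congr_fun this X
  set A := A₀ * B
  have hA : A ∈ S := hsemi _ hA₀ _ hB
  have hAA : A * A ≠ 0 := fun h =>
    htr (isNilpotent_trace_of_isNilpotent ⟨2, by rw [pow_two, h]⟩).eq_zero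
  have hminA : ∀ X ∈ S, X ≠ 0 → A.rank ≤ X.rank := fun X hX hX0 =>
    (rank_mul_le_left _ _).trans (hmin X hX hX0)
  clear_value A
  have hA0 : A ≠ 0 := by rintro rfl; simp at hAA
  -- the corner semigroup
  obtain ⟨r, hr⟩ : ∃ r, A.rank = r := ⟨_, rfl⟩
  obtain ⟨P, Q, hPQ⟩ := exists_rank_factorization A hr
  have hfull (Z : Matrix (Fin r) (Fin r) ℂ) (Q' : Matrix (Fin r) (Fin n) ℂ)
      (hmem : P * Z * Q' ∈ S) (h0 : P * Z * Q' ≠ 0) : Z.det ≠ 0 := by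
    have h1 : A.rank ≤ Z.rank := (hminA _ hmem h0).trans
      ((rank_mul_le_left _ _).trans (rank_mul_le_right _ _))
    have h2 : Z.rank = Fintype.card (Fin r) :=
      le_antisymm (rank_le_card_width _) (by simpa [hr] using h1)
    intro hdet
    obtain ⟨v, hv, hv0⟩ := exists_mulVec_eq_zero_iff.2 hdet
    have h3 := LinearMap.finrank_range_add_finrank_ker Z.mulVecLin
    rw [← Matrix.rank, h2, Module.finrank_fintype_fun_eq_card] at h3
    have h4 : LinearMap.ker Z.mulVecLin = ⊥ := Submodule.finrank_eq_zero.1 (by omega)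
    exact hv (LinearMap.ker_eq_bot'.1 h4 v hv0)
  have hD : IsUnit (Q * P).det := by
    have h : P * (Q * P) * Q = A * A := by
      conv_rhs => rw [hPQ]
      simp only [Matrix.mul_assoc]
    exact isUnit_iff_ne_zero.2 (hfull _ Q (h ▸ hsemi _ hA _ hA) (h ▸ hAA))
  set R := (Q * P)⁻¹ * Q with hR
  have hRP : R * P = 1 := by rw [hR, Matrix.mul_assoc, nonsing_inv_mul _ hD]
  have hPRA : A = P * (Q * P) * R := by
    rw [hR, Matrix.mul_assoc, mul_nonsing_inv_cancel_left _ _ hD, hPQ]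
  clear_value R
  have hAPR : A * P * R = A := by
    conv_rhs => rw [hPRA]
    rw [hPRA, Matrix.mul_assoc (P * (Q * P)), hRP, Matrix.mul_one]
  have hPRA' : P * R * A = A := by
    conv_lhs => rw [hPRA, Matrix.mul_assoc P R, Matrix.mul_assoc P (Q * P), ← Matrix.mul_assoc R P,
      hRP, Matrix.one_mul, ← Matrix.mul_assoc, ← hPRA]
  have hRAP : R * A * P = Q * P := by
    rw [hPRA, ← Matrix.mul_assoc R, ← Matrix.mul_assoc R, hRP, Matrix.one_mul, Matrix.mul_assoc,
      hRP, Matrix.mul_one]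
  have hcancel (Z : Matrix (Fin r) (Fin r) ℂ) : R * (P * Z * R) * P = Z := by
    rw [← Matrix.mul_assoc, ← Matrix.mul_assoc, hRP, Matrix.one_mul, Matrix.mul_assoc, hRP,
      Matrix.mul_one]
  let T : Set (Matrix (Fin r) (Fin r) ℂ) := {Z | P * Z * R ∈ S}
  have hTspan : Submodule.span ℂ T = ⊤ := by
    let Φ : Matrix (Fin n) (Fin n) ℂ →ₗ[ℂ] Matrix (Fin r) (Fin r) ℂ :=
      { toFun := fun X => R * (A * X * A) * P
        map_add' := fun X Y => by simp only [Matrix.mul_add, Matrix.add_mul]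
        map_smul' := fun c X => by simp }
    have hΦ : Submodule.map Φ (Submodule.span ℂ S) ≤ Submodule.span ℂ T := by
      rw [Submodule.map_span, Submodule.span_le]
      rintro _ ⟨X, hX, rfl⟩
      refine Submodule.subset_span ?_
      change P * (R * (A * X * A) * P) * R ∈ S
      have : P * (R * (A * X * A) * P) * R = (P * R * A) * X * (A * P * R) := by
        simp only [Matrix.mul_assoc]
      rw [this, hPRA', hAPR]
      exact hsemi _ (hsemi _ hA _ hX) _ hA
    refine eq_top_iff.2 fun W _ => hΦ ?_
    refine ⟨P * (Q * P)⁻¹ * W * (Q * P)⁻¹ * R, hspan ▸ Submodule.mem_top, ?_⟩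
    have hRAP' : R * A * P * (Q * P)⁻¹ = 1 := by rw [hRAP, mul_nonsing_inv _ hD]
    have hRAP'' : (Q * P)⁻¹ * (R * A * P) = 1 := by rw [hRAP, nonsing_inv_mul _ hD]
    calc R * (A * (P * (Q * P)⁻¹ * W * (Q * P)⁻¹ * R) * A) * P
        = (R * A * P * (Q * P)⁻¹) * W * ((Q * P)⁻¹ * (R * A * P)) := by
          simp only [Matrix.mul_assoc]
      _ = W := by rw [hRAP', hRAP'', Matrix.one_mul, Matrix.mul_one]
  obtain ⟨X, hX, Y, hY, hXY⟩ : ∃ X ∈ S, ∃ Y ∈ S, φ (X * A * Y) ≠ 0 := by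
    by_contra! h
    have h1 : ∀ X ∈ S, ∀ Y, φ (X * A * Y) = 0 := fun X hX Y =>
      LinearMap.congr_fun (LinearMap.ext_on hspan (h X hX) :
        φ ∘ₗ LinearMap.mulLeft ℂ (X * A) = 0) Y
    have h2 : ∀ X Y, φ (X * A * Y) = 0 := fun X Y => by
      have : φ ∘ₗ LinearMap.mulRight ℂ (A * Y) = 0 :=
        LinearMap.ext_on hspan fun X hX => by simpa [mul_assoc] using h1 X hX Y
      simpa [mul_assoc] using LinearMap.congr_fun this X
    let L : Submodule ℂ (Matrix (Fin n) (Fin n) ℂ) :=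
      { carrier := {W | ∀ X Y, φ (X * W * Y) = 0}
        zero_mem' := fun X Y => by simp
        add_mem' := fun ha hb X Y => by simp [mul_add, add_mul, ha X Y, hb X Y]
        smul_mem' := fun c W hW X Y => by simp [hW X Y] }
    have hL : L = ⊤ := by
      refine eq_top_of_mul_mem L (fun X W hW U Y => ?_) (fun X W hW U Y => ?_)
        (L.ne_bot_iff.2 ⟨A, h2, hA0⟩)
      · simpa [mul_assoc] using hW (U * X) Y
      · simpa [mul_assoc] using hW U (X * Y)
    refine hφ (LinearMap.ext fun W => ?_)
    have hW : W ∈ L := hL ▸ Submodule.mem_top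
    simpa using hW 1 1
  let ψ : Matrix (Fin r) (Fin r) ℂ →ₗ[ℂ] ℂ :=
    { toFun := fun Z => φ (X * (P * Z * R) * Y)
      map_add' := fun Z W => by simp only [Matrix.mul_add, Matrix.add_mul, map_add]
      map_smul' := fun c Z => by simp }
  have hcard : Fintype.card (Fin r) ≤ 1 := by
    refine card_le_one_of_nonneg_functional (T := T) ?_ (fun c hc Z hZ => ?_) (fun g hg h hh => ?_)
      (fun Z hZ hZ0 => hfull Z R hZ fun h0 => hZ0 ?_) hTspan ψ (fun h0 => hXY ?_) fun Z hZ => ?_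
    · exact hclosed.preimage
        ((continuous_const.matrix_mul continuous_id).matrix_mul continuous_const)
    · change P * ((c : ℂ) • Z) * R ∈ S
      rw [Matrix.mul_smul, Matrix.smul_mul]
      exact hsmul c hc _ hZ
    · change P * (g * h) * R ∈ S
      have : P * (g * h) * R = P * g * R * (P * h * R) := by
        calc P * (g * h) * R
            = P * g * (1 : Matrix (Fin r) (Fin r) ℂ) * h * R := by
              simp only [Matrix.mul_assoc, Matrix.one_mul]
          _ = P * g * R * (P * h * R) := by rw [← hRP]; simp only [Matrix.mul_assoc]
      exact this ▸ hsemi _ hg _ hh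
    · rw [← hcancel Z, h0, Matrix.mul_zero, Matrix.zero_mul]
    · have := LinearMap.congr_fun h0 (Q * P)
      change φ (X * (P * (Q * P) * R) * Y) = 0 at this
      rwa [← hPRA] at this
    · exact hpos _ (hsemi _ (hsemi _ hX _ hZ) _ hY)
  have hr0 : r ≠ 0 := by
    rintro rfl
    exact hA0 (hPQ.trans (by ext; simp [Matrix.mul_apply]))
  rw [Fintype.card_fin] at hcard
  exact ⟨A, hA, by omega⟩
end

section
/- Let n ≥ 2, let a = (1,1,…,1)ᵀ ∈ ℝ^n and b = (1,1,…,1,1−n)ᵀ ∈ ℝ^n, and set A = a aᵀ and B = b bᵀ in M_n(ℝ). Then A B = B A = 0, Aᵏ = n^{k−1} A and Bᵏ = (n(n−1))^{k−1} B for all k ≥ 1; consequently the multiplicative semigroup S generated by A and B is contained in ℝ₊A ∪ ℝ₊B, and every nonzero member of S has rank one, is indecomposable, and is diagonally similar to a matrix with all entries nonnegative. -/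
open Matrix

/-- A matrix is decomposable if some simultaneous permutation of rows and columns puts it in
block upper-triangular form with two nonempty square diagonal blocks, i.e. there are a
permutation `σ` and a threshold `k` with `0 < k < n` such that the lower-left block of the
permuted matrix vanishes. -/
def Decomposable {n : ℕ} {α : Type*} [Zero α] (A : Matrix (Fin n) (Fin n) α) : Prop :=
  ∃ σ : Equiv.Perm (Fin n), ∃ k : ℕ, 0 < k ∧ k < n ∧
    ∀ i j : Fin n, k ≤ (i : ℕ) → (j : ℕ) < k → A (σ i) (σ j) = 0

theorem sum_ite_val_eq_last {n : ℕ} (hn : 1 ≤ n) (c : ℝ) :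
    (∑ i : Fin n, if (i : ℕ) = n - 1 then c else 1) = n - 1 + c := by
  obtain ⟨m, rfl⟩ : ∃ m, n = m + 1 := ⟨n - 1, by omega⟩
  rw [Fin.sum_univ_castSucc]
  have h : ∀ i : Fin m, (i : ℕ) ≠ m := fun i => i.isLt.ne
  simp [h]

theorem vecMulVec_self_pow {ι R : Type*} [Fintype ι] [DecidableEq ι] [CommRing R]
    (u : ι → R) {k : ℕ} (hk : 1 ≤ k) :
    vecMulVec u u ^ k = (u ⬝ᵥ u) ^ (k - 1) • vecMulVec u u := by
  induction k, hk using Nat.le_induction with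
  | base => simp
  | succ k hk ih =>
    rw [pow_succ, ih, smul_mul_assoc, vecMulVec_mul_vecMulVec, vecMulVec_smul, smul_smul,
      ← pow_succ]
    congr 2
    omega

theorem smul_vecMulVec_self_properties {n : ℕ} {u : Fin n → ℝ} (hu : ∀ i, u i ≠ 0)
    {r : ℝ} (hr : 0 ≤ r) (h0 : r • vecMulVec u u ≠ 0) :
    (r • vecMulVec u u).rank = 1 ∧ ¬ Decomposable (r • vecMulVec u u) ∧
      ∃ d : Fin n → ℝ, (∀ i, d i ≠ 0) ∧
        ∀ i j, 0 ≤ (diagonal d * (r • vecMulVec u u) * diagonal (fun i => (d i)⁻¹)) i j := by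
  have hr0 : r ≠ 0 := by
    rintro rfl
    simp at h0
  refine ⟨le_antisymm ?_ ?_, ?_, u, hu, fun i j => ?_⟩
  · rw [← smul_vecMulVec]
    exact rank_vecMulVec_le _ _
  · rw [Nat.one_le_iff_ne_zero]
    intro h
    rw [Matrix.rank, Submodule.finrank_eq_zero, LinearMap.range_eq_bot] at h
    exact h0 (toLin'.map_eq_zero_iff.mp h)
  · rintro ⟨σ, k, hk, hkn, h⟩
    have := h ⟨k, hkn⟩ ⟨0, hk.trans hkn⟩ le_rfl hk
    simp [vecMulVec_apply, hr0, hu] at this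
  · rw [mul_diagonal, diagonal_mul, Matrix.smul_apply, vecMulVec_apply, smul_eq_mul]
    have : u i * (r * (u i * u j)) * (u j)⁻¹ = r * u i ^ 2 := by
      field_simp [hu j]
    rw [this]
    positivity

/-- For `a = (1,…,1)ᵀ`, `b = (1,…,1,1−n)ᵀ`, `A = aaᵀ`, `B = bbᵀ`:
`AB = BA = 0`, `Aᵏ = n^{k−1}A`, `Bᵏ = (n(n−1))^{k−1}B`; the semigroup generated by `A` and `B`
is contained in `ℝ₊A ∪ ℝ₊B`, and every nonzero member has rank one, is indecomposable, and is
diagonally similar to a nonnegative matrix. -/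
theorem stmt_3 {n : ℕ} (hn : 2 ≤ n)
    (a b : Fin n → ℝ) (ha : a = fun _ : Fin n => 1)
    (hb : b = fun i : Fin n => if (i : ℕ) = n - 1 then 1 - (n : ℝ) else 1)
    (A B : Matrix (Fin n) (Fin n) ℝ)
    (hA : A = vecMulVec a a) (hB : B = vecMulVec b b) :
    A * B = 0 ∧ B * A = 0 ∧
    (∀ k : ℕ, 1 ≤ k → A ^ k = (n : ℝ) ^ (k - 1) • A ∧
      B ^ k = ((n : ℝ) * ((n : ℝ) - 1)) ^ (k - 1) • B) ∧
    (∀ M ∈ Subsemigroup.closure ({A, B} : Set (Matrix (Fin n) (Fin n) ℝ)),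
      ∃ r : ℝ, 0 ≤ r ∧ (M = r • A ∨ M = r • B)) ∧
    (∀ M ∈ Subsemigroup.closure ({A, B} : Set (Matrix (Fin n) (Fin n) ℝ)),
      M ≠ 0 → M.rank = 1 ∧ ¬ Decomposable M ∧
        ∃ d : Fin n → ℝ, (∀ i, d i ≠ 0) ∧
          ∀ i j, 0 ≤ (diagonal d * M * diagonal (fun i => (d i)⁻¹)) i j) := by
  have ha0 : ∀ i, a i ≠ 0 := by simp [ha]
  have hn1 : (2 : ℝ) ≤ n := by exact_mod_cast hn
  have hb0 : ∀ i, b i ≠ 0 := by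
    intro i
    rw [hb]
    dsimp only
    split_ifs
    · linarith
    · exact one_ne_zero
  have haa : a ⬝ᵥ a = n := by simp [ha, dotProduct]
  have hab : a ⬝ᵥ b = 0 := by
    simp only [ha, hb, dotProduct, one_mul]
    rw [sum_ite_val_eq_last (by omega)]
    ring
  have hbb : b ⬝ᵥ b = n * (n - 1) := by
    have h : ∀ i : Fin n, b i * b i = if (i : ℕ) = n - 1 then (1 - (n : ℝ)) ^ 2 else 1 := by
      intro i
      rw [hb]
      dsimp only
      split_ifs <;> ring
    simp only [dotProduct, h]
    rw [sum_ite_val_eq_last (by omega)]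
    ring
  have hAB : A * B = 0 := by
    rw [hA, hB, vecMulVec_mul_vecMulVec, hab, zero_smul, vecMulVec_zero]
  have hBA : B * A = 0 := by
    rw [hA, hB, vecMulVec_mul_vecMulVec, dotProduct_comm, hab, zero_smul, vecMulVec_zero]
  have hAA : A * A = (n : ℝ) • A := by
    rw [hA, vecMulVec_mul_vecMulVec, haa, vecMulVec_smul]
  have hBB : B * B = ((n : ℝ) * (n - 1)) • B := by
    rw [hB, vecMulVec_mul_vecMulVec, hbb, vecMulVec_smul]
  have hcl : ∀ M ∈ Subsemigroup.closure ({A, B} : Set (Matrix (Fin n) (Fin n) ℝ)),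
      ∃ r : ℝ, 0 ≤ r ∧ (M = r • A ∨ M = r • B) := by
    intro M hM
    induction hM using Subsemigroup.closure_induction with
    | mem M hM =>
      rcases hM with rfl | rfl
      · exact ⟨1, zero_le_one, Or.inl (one_smul ℝ _).symm⟩
      · exact ⟨1, zero_le_one, Or.inr (one_smul ℝ _).symm⟩
    | mul M N _ _ hM hN =>
      obtain ⟨r, hr, hM⟩ := hM
      obtain ⟨s, hs, hN⟩ := hN
      have hc : (0 : ℝ) ≤ n - 1 := by linarith
      rcases hM with rfl | rfl <;> rcases hN with rfl | rfl <;>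
        rw [smul_mul_smul_comm]
      · exact ⟨r * s * n, by positivity, Or.inl (by rw [hAA, smul_smul])⟩
      · exact ⟨0, le_rfl, Or.inl (by rw [hAB, smul_zero, zero_smul])⟩
      · exact ⟨0, le_rfl, Or.inl (by rw [hBA, smul_zero, zero_smul])⟩
      · exact ⟨r * s * (n * (n - 1)), by positivity, Or.inr (by rw [hBB, smul_smul])⟩
  refine ⟨hAB, hBA, fun k hk => ⟨?_, ?_⟩, hcl, fun M hM hM0 => ?_⟩
  · rw [hA, vecMulVec_self_pow a hk, haa]
  · rw [hB, vecMulVec_self_pow b hk, hbb]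
  · obtain ⟨r, hr, rfl | rfl⟩ := hcl M hM
    · rw [hA] at hM0 ⊢
      exact smul_vecMulVec_self_properties ha0 hr hM0
    · rw [hB] at hM0 ⊢
      exact smul_vecMulVec_self_properties hb0 hr hM0
end

section
/- Let n ≥ 2, let a = (1,1,…,1)ᵀ ∈ ℝ^n and b = (1,1,…,1,1−n)ᵀ ∈ ℝ^n, and set A = a aᵀ and B = b bᵀ in M_n(ℝ). Then there is no single invertible diagonal matrix D ∈ M_n(ℂ) such that both D A D⁻¹ and D B D⁻¹ have all entries nonnegative real; in particular, the multiplicative semigroup generated by A and B is not diagonally similar to a semigroup of nonnegative matrices, even though each of its members individually is diagonally similar to a nonnegative matrix. -/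
open Matrix

/-- Entries of a conjugate by a diagonal matrix. -/
theorem diagonal_mul_mul_diagonal_apply {ι : Type*} [Fintype ι] [DecidableEq ι]
    (d e : ι → ℂ) (M : Matrix ι ι ℂ) (i j : ι) :
    (diagonal d * M * diagonal e) i j = d i * M i j * e j := by
  rw [mul_diagonal, diagonal_mul]

/-- If `aaᵀ` and `bbᵀ` annihilate each other and the squared lengths of `a` and `b` are nonnegative
reals, every member of the semigroup they generate is a nonnegative multiple of a generator. -/
theorem exists_smul_of_mem_closure_vecMulVec {ι : Type*} [Fintype ι] {a b : ι → ℂ} {p q : ℝ}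
    (hp : 0 ≤ p) (hq : 0 ≤ q) (haa : a ⬝ᵥ a = p) (hbb : b ⬝ᵥ b = q) (hab : a ⬝ᵥ b = 0)
    {M : Matrix ι ι ℂ}
    (hM : M ∈ Subsemigroup.closure ({vecMulVec a a, vecMulVec b b} : Set (Matrix ι ι ℂ))) :
    ∃ c : ℝ, 0 ≤ c ∧ (M = (c : ℂ) • vecMulVec a a ∨ M = (c : ℂ) • vecMulVec b b) := by
  have hba : b ⬝ᵥ a = 0 := by rw [dotProduct_comm, hab]
  induction hM using Subsemigroup.closure_induction with
  | mem M hM =>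
    refine ⟨1, zero_le_one, ?_⟩
    simpa using hM
  | mul M N _ _ ihM ihN =>
    obtain ⟨c, hc, rfl | rfl⟩ := ihM <;> obtain ⟨e, he, rfl | rfl⟩ := ihN
    · refine ⟨c * e * p, by positivity, Or.inl ?_⟩
      rw [smul_mul_smul_comm, vecMulVec_mul_vecMulVec, haa, vecMulVec_smul, smul_smul]
      push_cast
      rfl
    · exact ⟨0, le_rfl, Or.inl (by simp [vecMulVec_mul_vecMulVec, hab])⟩
    · exact ⟨0, le_rfl, Or.inl (by simp [vecMulVec_mul_vecMulVec, hba])⟩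
    · refine ⟨c * e * q, by positivity, Or.inr ?_⟩
      rw [smul_mul_smul_comm, vecMulVec_mul_vecMulVec, hbb, vecMulVec_smul, smul_smul]
      push_cast
      rfl

/-- For `a = (1,…,1)ᵀ`, `b = (1,…,1,1−n)ᵀ`, `A = aaᵀ`, `B = bbᵀ` (viewed in
`M_n(ℂ)`): no single invertible complex diagonal matrix conjugates both `A` and `B` to matrices
with nonnegative real entries; in particular the semigroup generated by `A` and `B` is not
diagonally similar to a semigroup of nonnegative matrices, although each of its members
individually is diagonally similar to a nonnegative matrix. -/
theorem stmt_4 {n : ℕ} (hn : 2 ≤ n)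
    (a b : Fin n → ℂ) (ha : a = fun _ : Fin n => 1)
    (hb : b = fun i : Fin n => if (i : ℕ) = n - 1 then 1 - (n : ℂ) else 1)
    (A B : Matrix (Fin n) (Fin n) ℂ)
    (hA : A = vecMulVec a a) (hB : B = vecMulVec b b) :
    (¬ ∃ d : Fin n → ℂ, (∀ i, d i ≠ 0) ∧
        (∀ i j, 0 ≤ ((diagonal d * A * diagonal (fun i => (d i)⁻¹)) i j).re ∧
          ((diagonal d * A * diagonal (fun i => (d i)⁻¹)) i j).im = 0) ∧
        (∀ i j, 0 ≤ ((diagonal d * B * diagonal (fun i => (d i)⁻¹)) i j).re ∧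
          ((diagonal d * B * diagonal (fun i => (d i)⁻¹)) i j).im = 0)) ∧
    (¬ ∃ d : Fin n → ℂ, (∀ i, d i ≠ 0) ∧
        ∀ M ∈ Subsemigroup.closure ({A, B} : Set (Matrix (Fin n) (Fin n) ℂ)),
          ∀ i j, 0 ≤ ((diagonal d * M * diagonal (fun i => (d i)⁻¹)) i j).re ∧
            ((diagonal d * M * diagonal (fun i => (d i)⁻¹)) i j).im = 0) ∧
    (∀ M ∈ Subsemigroup.closure ({A, B} : Set (Matrix (Fin n) (Fin n) ℂ)),
      ∃ d : Fin n → ℂ, (∀ i, d i ≠ 0) ∧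
        ∀ i j, 0 ≤ ((diagonal d * M * diagonal (fun i => (d i)⁻¹)) i j).re ∧
          ((diagonal d * M * diagonal (fun i => (d i)⁻¹)) i j).im = 0) := by
  have hn' : (2 : ℝ) ≤ n := by exact_mod_cast hn
  have key : ¬ ∃ d : Fin n → ℂ, (∀ i, d i ≠ 0) ∧
      (∀ i j, 0 ≤ ((diagonal d * A * diagonal (fun i => (d i)⁻¹)) i j).re ∧
        ((diagonal d * A * diagonal (fun i => (d i)⁻¹)) i j).im = 0) ∧
      (∀ i j, 0 ≤ ((diagonal d * B * diagonal (fun i => (d i)⁻¹)) i j).re ∧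
        ((diagonal d * B * diagonal (fun i => (d i)⁻¹)) i j).im = 0) := by
    rintro ⟨d, hd, h1, h2⟩
    let i : Fin n := ⟨0, by omega⟩
    let j : Fin n := ⟨n - 1, by omega⟩
    have hi : b i = 1 := by
      rw [hb]
      exact if_neg (show ¬ (0 = n - 1) by omega)
    have hj : b j = 1 - (n : ℂ) := by
      rw [hb]
      exact if_pos rfl
    have h1' := h1 i j
    have h2' := (h2 i j).1
    have hne : d i * (d j)⁻¹ ≠ 0 := mul_ne_zero (hd i) (inv_ne_zero (hd j))
    have hAe : d i * A i j * (d j)⁻¹ = d i * (d j)⁻¹ := by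
      simp [hA, ha, vecMulVec_apply]
    have hBe : d i * B i j * (d j)⁻¹ = ((1 - n : ℝ) : ℂ) * (d i * (d j)⁻¹) := by
      rw [hB, vecMulVec_apply, hi, hj]
      push_cast
      ring
    rw [diagonal_mul_mul_diagonal_apply, hAe] at h1'
    rw [diagonal_mul_mul_diagonal_apply, hBe, Complex.re_ofReal_mul] at h2'
    have h0 : (d i * (d j)⁻¹).re = 0 := by nlinarith [h1'.1]
    exact hne (Complex.ext h0 h1'.2)
  refine ⟨key, ?_, ?_⟩
  · rintro ⟨d, hd, h⟩
    exact key ⟨d, hd, h A (Subsemigroup.subset_closure (by simp)),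
      h B (Subsemigroup.subset_closure (by simp))⟩
  · intro M hM
    obtain ⟨m, rfl⟩ : ∃ m, n = m + 1 := ⟨n - 1, by omega⟩
    have hblast : b (Fin.last m) = -(m : ℂ) := by
      simp [hb]
    have hbcast (i : Fin m) : b i.castSucc = 1 := by
      have := i.isLt.ne
      simp [hb, this]
    have haa : a ⬝ᵥ a = ((m + 1 : ℝ) : ℂ) := by
      simp [ha, dotProduct]
    have hbb : b ⬝ᵥ b = ((m + m ^ 2 : ℝ) : ℂ) := by
      simp [dotProduct, Fin.sum_univ_castSucc, hblast, hbcast, sq]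
    have hab : a ⬝ᵥ b = 0 := by
      simp [ha, dotProduct, Fin.sum_univ_castSucc, hblast, hbcast]
    rw [hA, hB] at hM
    obtain ⟨c, hc, rfl | rfl⟩ :=
      exists_smul_of_mem_closure_vecMulVec (by positivity) (by positivity) haa hbb hab hM
    · refine ⟨fun _ => 1, by simp, fun i j => ?_⟩
      rw [diagonal_mul_mul_diagonal_apply]
      simp [ha, vecMulVec_apply, hc]
    · let s : Fin (m + 1) → ℂ := Fin.lastCases (-1) (fun _ => 1)
      have hs (i : Fin (m + 1)) : s i ≠ 0 ∧ (s i)⁻¹ = s i ∧ ∃ r : ℝ, 0 ≤ r ∧ s i * b i = r := by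
        induction i using Fin.lastCases with
        | last => exact ⟨by simp [s], by simp [s, inv_neg], m, by positivity, by simp [s, hblast]⟩
        | cast i => exact ⟨by simp [s], by simp [s], 1, zero_le_one, by simp [s, hbcast]⟩
      refine ⟨s, fun i => (hs i).1, fun i j => ?_⟩
      obtain ⟨-, -, x, hx, hxi⟩ := hs i
      obtain ⟨-, hinv, y, hy, hyj⟩ := hs j
      have he : s i * ((c : ℂ) • vecMulVec b b) i j * (s j)⁻¹ = ((c * x * y : ℝ) : ℂ) := by
        rw [hinv, Matrix.smul_apply, vecMulVec_apply, smul_eq_mul]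
        push_cast
        rw [← hxi, ← hyj]
        ring
      rw [diagonal_mul_mul_diagonal_apply, he]
      exact ⟨by rw [Complex.ofReal_re]; positivity, Complex.ofReal_im _⟩
end

section
/- Let C ⊆ M_n(ℂ) be a collection of matrices in which each member is diagonally similar to a matrix with all entries nonnegative real. Then every matrix in the closure (in the Euclidean topology on M_n(ℂ)) of the homogenization ℝ₊C is also diagonally similar to a matrix with all entries nonnegative real. -/
open Matrix

/-- A complex matrix is diagonally similar to a matrix with all entries nonnegative real if
some invertible diagonal conjugation takes it to such a matrix. -/
def DiagSimNonneg {n : ℕ} (A : Matrix (Fin n) (Fin n) ℂ) : Prop :=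
  ∃ d : Fin n → ℂ, (∀ i, d i ≠ 0) ∧
    ∀ i j, 0 ≤ ((diagonal d * A * diagonal (fun i => (d i)⁻¹)) i j).re ∧
      ((diagonal d * A * diagonal (fun i => (d i)⁻¹)) i j).im = 0

theorem diagSimNonneg_iff {n : ℕ} {A : Matrix (Fin n) (Fin n) ℂ} :
    DiagSimNonneg A ↔ ∃ d : Fin n → ℂ, (∀ i, d i ≠ 0) ∧
      ∀ i j, 0 ≤ (d i * A i j * (d j)⁻¹).re ∧ (d i * A i j * (d j)⁻¹).im = 0 := by
  simp only [DiagSimNonneg, mul_diagonal, diagonal_mul]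

/-- The diagonal conjugation can be chosen unitary. -/
theorem diagSimNonneg_iff_exists_circle {n : ℕ} {A : Matrix (Fin n) (Fin n) ℂ} :
    DiagSimNonneg A ↔ ∃ u : Fin n → Circle, ∀ i j,
      0 ≤ ((u i : ℂ) * A i j * ((u j)⁻¹ : Circle)).re ∧
        ((u i : ℂ) * A i j * ((u j)⁻¹ : Circle)).im = 0 := by
  rw [diagSimNonneg_iff]
  constructor
  · rintro ⟨d, hd, h⟩
    refine ⟨fun i => ⟨d i / ‖d i‖, ?_⟩, fun i j => ?_⟩
    · exact mem_sphere_zero_iff_norm.2 (by simp [hd i])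
    · have key : d i / ‖d i‖ * A i j * (d j / ‖d j‖)⁻¹ =
          ((‖d j‖ / ‖d i‖ : ℝ) : ℂ) * (d i * A i j * (d j)⁻¹) := by
        push_cast
        rw [inv_div]
        ring
      change 0 ≤ (d i / ‖d i‖ * A i j * (d j / ‖d j‖)⁻¹).re ∧
        (d i / ‖d i‖ * A i j * (d j / ‖d j‖)⁻¹).im = 0
      rw [key, Complex.re_ofReal_mul, Complex.im_ofReal_mul, (h i j).2]
      exact ⟨mul_nonneg (by positivity) (h i j).1, mul_zero _⟩
  · rintro ⟨u, h⟩
    exact ⟨fun i => u i, fun i => (u i).coe_ne_zero, by simpa only [Circle.coe_inv] using h⟩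

theorem DiagSimNonneg.smul {n : ℕ} {A : Matrix (Fin n) (Fin n) ℂ} (hA : DiagSimNonneg A)
    {r : ℝ} (hr : 0 ≤ r) : DiagSimNonneg ((r : ℂ) • A) := by
  rw [diagSimNonneg_iff] at hA ⊢
  obtain ⟨d, hd, h⟩ := hA
  refine ⟨d, hd, fun i j => ?_⟩
  rw [Matrix.smul_apply, smul_eq_mul, mul_left_comm, mul_assoc (r : ℂ),
    Complex.re_ofReal_mul, Complex.im_ofReal_mul, (h i j).2]
  exact ⟨mul_nonneg hr (h i j).1, mul_zero _⟩

theorem isClosed_setOf_diagSimNonneg (n : ℕ) :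
    IsClosed {A : Matrix (Fin n) (Fin n) ℂ | DiagSimNonneg A} := by
  have hclosed : IsClosed {p : (Fin n → Circle) × Matrix (Fin n) (Fin n) ℂ | ∀ i j,
      0 ≤ ((p.1 i : ℂ) * p.2 i j * ((p.1 j)⁻¹ : Circle)).re ∧
        ((p.1 i : ℂ) * p.2 i j * ((p.1 j)⁻¹ : Circle)).im = 0} := by
    simp only [Set.ofPred_forall]
    refine isClosed_iInter fun i => isClosed_iInter fun j => ?_
    have hc : Continuous fun p : (Fin n → Circle) × Matrix (Fin n) (Fin n) ℂ =>
        (p.1 i : ℂ) * p.2 i j * ((p.1 j)⁻¹ : Circle) :=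
      ((continuous_subtype_val.comp (by fun_prop)).mul (continuous_snd.matrix_elem i j)).mul
        (continuous_subtype_val.comp (by fun_prop))
    exact (isClosed_le continuous_const (Complex.continuous_re.comp hc)).inter
      (isClosed_eq (Complex.continuous_im.comp hc) continuous_const)
  convert isClosedMap_snd_of_compactSpace _ hclosed using 1
  ext A
  simp [diagSimNonneg_iff_exists_circle]

/-- If every member of a collection `C ⊆ M_n(ℂ)` is diagonally similar to a
nonnegative matrix, then so is every matrix in the closure of the homogenization `ℝ₊C`. -/
theorem stmt_5 {n : ℕ} (C : Set (Matrix (Fin n) (Fin n) ℂ))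
    (h : ∀ A ∈ C, DiagSimNonneg A) :
    ∀ A ∈ closure {M | ∃ r : ℝ, 0 ≤ r ∧ ∃ B ∈ C, M = (r : ℂ) • B}, DiagSimNonneg A := by
  refine fun A hA => closure_minimal ?_ (isClosed_setOf_diagSimNonneg n) hA
  rintro _ ⟨r, hr, B, hB, rfl⟩
  exact (h B hB).smul hr
end

section
/- Let n ≥ 2, let A ∈ M_n(ℝ) be an indecomposable matrix, and let D be a diagonal matrix each of whose diagonal entries is 1 or −1, such that D A D has all entries nonnegative. If there exists a proper cone K ⊆ ℝ₊^n with A(K) ⊆ K, then D = I or D = −I, and A itself has all entries nonnegative. -/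
open Matrix

/-- A proper cone in `ℝⁿ`: a closed convex cone that is pointed (`K ∩ (−K) = {0}`) and solid
(nonempty interior). -/
def IsProperCone {n : ℕ} (K : Set (Fin n → ℝ)) : Prop :=
  (0 : Fin n → ℝ) ∈ K ∧ (∀ x ∈ K, ∀ y ∈ K, x + y ∈ K) ∧
  (∀ r : ℝ, 0 ≤ r → ∀ x ∈ K, r • x ∈ K) ∧ IsClosed K ∧
  (∀ x ∈ K, -x ∈ K → x = 0) ∧ (interior K).Nonempty

/-- If no permutation block-triangularises `A`, then a nonempty set of indices that absorbs every
nonzero entry of `A` (row index from column index) is everything. -/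
lemma eq_univ_of_not_decomposable {n : ℕ} {α : Type*} [Zero α] {A : Matrix (Fin n) (Fin n) α}
    (hind : ¬ Decomposable A) (R : Set (Fin n)) (hne : R.Nonempty)
    (hR : ∀ k i, i ∈ R → A k i ≠ 0 → k ∈ R) : R = Set.univ := by
  classical
  by_contra hu
  obtain ⟨b, hb⟩ := (Set.ne_univ_iff_exists_notMem R).1 hu
  obtain ⟨a, ha⟩ := hne
  have hlt : Fintype.card {i // i ∈ R} < n := by
    simpa using Fintype.card_subtype_lt (p := fun i => i ∈ R) hb
  have hcard : Fintype.card {i : Fin n // (i : ℕ) < Fintype.card {i // i ∈ R}} =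
      Fintype.card {i // i ∈ R} := by
    rw [Fintype.card_subtype, Fin.card_filter_val_lt, min_eq_right hlt.le]
  let e := Fintype.equivOfCardEq hcard
  refine hind ⟨e.extendSubtype, Fintype.card {i // i ∈ R},
    Fintype.card_pos_iff.2 ⟨⟨a, ha⟩⟩, hlt, fun i j hi hj => ?_⟩
  by_contra h
  exact e.extendSubtype_not_mem i (not_lt.2 hi) (hR _ _ (e.extendSubtype_mem j hj) h)

lemma one_add_pow_entry_nonneg {n : ℕ} {B : Matrix (Fin n) (Fin n) ℝ} (hB : ∀ i j, 0 ≤ B i j)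
    (N : ℕ) (i j : Fin n) : 0 ≤ ((1 + B) ^ N) i j := by
  induction N generalizing i with
  | zero => rw [pow_zero, one_apply]; split_ifs <;> norm_num
  | succ N ih =>
    rw [pow_succ', add_mul, one_mul, Matrix.add_apply, mul_apply]
    exact add_nonneg (ih i) (Finset.sum_nonneg fun k _ => mul_nonneg (hB i k) (ih k))

lemma one_add_pow_entry_mono {n : ℕ} {B : Matrix (Fin n) (Fin n) ℝ} (hB : ∀ i j, 0 ≤ B i j)
    (i j : Fin n) : Monotone fun N : ℕ => ((1 + B) ^ N) i j := by
  refine monotone_nat_of_le_succ fun N => ?_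
  rw [pow_succ', add_mul, one_mul, Matrix.add_apply, mul_apply]
  exact le_add_of_nonneg_right
    (Finset.sum_nonneg fun k _ => mul_nonneg (hB i k) (one_add_pow_entry_nonneg hB N k j))

/-- Some power of `1 + B` is entrywise positive when `B` is nonnegative and indecomposable. -/
lemma exists_one_add_pow_pos {n : ℕ} {B : Matrix (Fin n) (Fin n) ℝ} (hB : ∀ i j, 0 ≤ B i j)
    (hind : ¬ Decomposable B) : ∃ N : ℕ, ∀ i j, 0 < ((1 + B) ^ N) i j := by
  have key : ∀ i j, ∃ N : ℕ, 0 < ((1 + B) ^ N) i j := by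
    intro i j
    have hu := eq_univ_of_not_decomposable hind {i | ∃ N : ℕ, 0 < ((1 + B) ^ N) i j}
      ⟨j, 0, by simp⟩ (by
        rintro k l ⟨N, hN⟩ hkl
        refine ⟨N + 1, ?_⟩
        rw [pow_succ', add_mul, one_mul, Matrix.add_apply, mul_apply]
        refine add_pos_of_nonneg_of_pos (one_add_pow_entry_nonneg hB N k j) ?_
        exact Finset.sum_pos' (fun l _ => mul_nonneg (hB k l) (one_add_pow_entry_nonneg hB N l j))
          ⟨l, Finset.mem_univ l, mul_pos ((hB k l).lt_of_ne' hkl) hN⟩)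
    exact Set.eq_univ_iff_forall.1 hu i
  choose f hf using key
  refine ⟨∑ i, ∑ j, f i j, fun i j => (hf i j).trans_le (one_add_pow_entry_mono hB i j ?_)⟩
  exact (Finset.single_le_sum (f := fun j => f i j) (fun _ _ => Nat.zero_le _)
    (Finset.mem_univ j)).trans (Finset.single_le_sum (f := fun i => ∑ j, f i j)
      (fun _ _ => Nat.zero_le _) (Finset.mem_univ i))

/-- A matrix with entries in `[m, M]`, `0 < m`, contracts the range of the coordinatewise ratio
`w / a` by the factor `1 - m / M`. -/
lemma exists_ratio_bounds_mulVec {ι : Type*} [Fintype ι] [Nonempty ι] {P : Matrix ι ι ℝ}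
    {m M : ℝ} (hm : 0 < m) (hP : ∀ i j, m ≤ P i j) (hM : ∀ i j, P i j ≤ M)
    {a w : ι → ℝ} (ha : ∀ i, 0 < a i) {α β : ℝ}
    (hα : ∀ i, α * a i ≤ w i) (hβ : ∀ i, w i ≤ β * a i) :
    ∃ α' β', β' - α' = (1 - m / M) * (β - α) ∧
      ∀ i, α' * (P *ᵥ a) i ≤ (P *ᵥ w) i ∧ (P *ᵥ w) i ≤ β' * (P *ᵥ a) i := by
  obtain ⟨i₀⟩ := ‹Nonempty ι›
  have hM0 : 0 < M := hm.trans_le ((hP i₀ i₀).trans (hM i₀ i₀))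
  have hsum : 0 < ∑ i, a i := Finset.sum_pos (fun i _ => ha i) ⟨i₀, Finset.mem_univ i₀⟩
  have lower : ∀ v : ι → ℝ, (∀ i, 0 ≤ v i) → ∀ i, m * ∑ k, v k ≤ (P *ᵥ v) i := fun v hv i => by
    rw [Finset.mul_sum]
    exact Finset.sum_le_sum fun k _ => mul_le_mul_of_nonneg_right (hP i k) (hv k)
  have upper : ∀ i, (P *ᵥ a) i ≤ M * ∑ k, a k := fun i => by
    rw [Finset.mul_sum]
    exact Finset.sum_le_sum fun k _ => mul_le_mul_of_nonneg_right (hM i k) (ha k).le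
  have key : ∀ v : ι → ℝ, (∀ i, 0 ≤ v i) → ∀ i,
      m / M * ((∑ k, v k) / ∑ k, a k) * (P *ᵥ a) i ≤ (P *ᵥ v) i := fun v hv i => by
    have hs : 0 ≤ ∑ k, v k := Finset.sum_nonneg fun k _ => hv k
    calc m / M * ((∑ k, v k) / ∑ k, a k) * (P *ᵥ a) i
        ≤ m / M * ((∑ k, v k) / ∑ k, a k) * (M * ∑ k, a k) := by
          gcongr
          exact upper i
      _ = m * ∑ k, v k := by field_simp
      _ ≤ (P *ᵥ v) i := lower v hv i
  have h₁ := key (w - α • a) fun i => by simpa using hα i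
  have h₂ := key (β • a - w) fun i => by simpa using hβ i
  refine ⟨α + m / M * ((∑ k, (w - α • a) k) / ∑ k, a k),
    β - m / M * ((∑ k, (β • a - w) k) / ∑ k, a k), ?_, fun i => ⟨?_, ?_⟩⟩
  · simp only [Pi.sub_apply, Pi.smul_apply, smul_eq_mul, Finset.sum_sub_distrib, ← Finset.mul_sum]
    field_simp
    ring
  · have := h₁ i
    rw [mulVec_sub, mulVec_smul, Pi.sub_apply, Pi.smul_apply, smul_eq_mul] at this
    linarith
  · have := h₂ i
    rw [mulVec_sub, mulVec_smul, Pi.sub_apply, Pi.smul_apply, smul_eq_mul] at this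
    linarith

/-- For an entrywise positive matrix `P`, the coordinatewise ratios of `P ^ k *ᵥ w` and
`P ^ k *ᵥ 1` become arbitrarily close to each other. -/
lemma exists_pow_ratio_bounds {ι : Type*} [Fintype ι] [DecidableEq ι] [Nonempty ι]
    {P : Matrix ι ι ℝ} (hP : ∀ i j, 0 < P i j) (w : ι → ℝ) {ε : ℝ} (hε : 0 < ε) :
    ∃ (k : ℕ) (α β : ℝ), β - α < ε ∧ ∀ i, 0 < (P ^ k *ᵥ 1) i ∧
      α * (P ^ k *ᵥ 1) i ≤ (P ^ k *ᵥ w) i ∧ (P ^ k *ᵥ w) i ≤ β * (P ^ k *ᵥ 1) i := by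
  obtain ⟨p, hp⟩ := Finite.exists_min fun p : ι × ι => P p.1 p.2
  obtain ⟨r, hr⟩ := Finite.exists_max fun p : ι × ι => P p.1 p.2
  set m := P p.1 p.2
  set M := P r.1 r.2
  have hm : 0 < m := hP _ _
  have hM : 0 < M := hP _ _
  obtain ⟨u, hu⟩ := Finite.exists_min w
  obtain ⟨v, hv⟩ := Finite.exists_max w
  have iter : ∀ k : ℕ, ∃ α β : ℝ, β - α = (1 - m / M) ^ k * (w v - w u) ∧
      ∀ i, 0 < (P ^ k *ᵥ 1) i ∧
        α * (P ^ k *ᵥ 1) i ≤ (P ^ k *ᵥ w) i ∧ (P ^ k *ᵥ w) i ≤ β * (P ^ k *ᵥ 1) i := by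
    intro k
    induction k with
    | zero => exact ⟨w u, w v, by simp, fun i => by simpa using ⟨hu i, hv i⟩⟩
    | succ k ih =>
      obtain ⟨α, β, hαβ, h⟩ := ih
      obtain ⟨α', β', hαβ', h'⟩ := exists_ratio_bounds_mulVec hm (fun i j => hp (i, j))
        (fun i j => hr (i, j)) (fun i => (h i).1) (fun i => (h i).2.1) fun i => (h i).2.2
      refine ⟨α', β', by rw [hαβ', hαβ]; ring, fun i => ?_⟩
      rw [pow_succ', ← mulVec_mulVec, ← mulVec_mulVec]
      exact ⟨Finset.sum_pos (fun j _ => mul_pos (hP i j) (h j).1) Finset.univ_nonempty, h' i⟩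
  have hq : m / M ≤ 1 := (div_le_one hM).2 (hp r)
  have hlim := (tendsto_pow_atTop_nhds_zero_of_lt_one (sub_nonneg.2 hq)
    (sub_lt_self 1 (div_pos hm hM))).mul_const (w v - w u)
  rw [zero_mul] at hlim
  obtain ⟨k, hk⟩ := (hlim.eventually (gt_mem_nhds hε)).exists
  obtain ⟨α, β, hαβ, h⟩ := iter k
  exact ⟨k, α, β, hαβ ▸ hk, h⟩

lemma one_add_pow_mulVec_mem {n : ℕ} {A : Matrix (Fin n) (Fin n) ℝ} {K : Set (Fin n → ℝ)}
    (hadd : ∀ x ∈ K, ∀ y ∈ K, x + y ∈ K) (hKinv : ∀ x ∈ K, A *ᵥ x ∈ K) (N : ℕ)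
    {x : Fin n → ℝ} (hx : x ∈ K) : (1 + A) ^ N *ᵥ x ∈ K := by
  induction N with
  | zero => simpa using hx
  | succ N ih =>
    rw [pow_succ', ← mulVec_mulVec, add_mulVec, one_mulVec]
    exact hadd _ ih _ (hKinv _ ih)

/-- An interior point of a set in `ℝⁿ` can be moved slightly both ways in a given direction. -/
lemma exists_pos_add_sub_smul_mem {E : Type*} [AddCommGroup E] [Module ℝ E] [TopologicalSpace E]
    [ContinuousAdd E] [ContinuousSMul ℝ E] {K : Set E} {x : E} (hx : x ∈ interior K) (v : E) :
    ∃ ε : ℝ, 0 < ε ∧ x + ε • v ∈ K ∧ x + (-ε) • v ∈ K := by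
  have hc : Continuous fun t : ℝ => x + t • v := by fun_prop
  have hmem : (fun t : ℝ => x + t • v) ⁻¹' K ∈ nhds (0 : ℝ) :=
    hc.continuousAt.preimage_mem_nhds (by simpa using mem_interior_iff_mem_nhds.1 hx)
  obtain ⟨δ, hδ, hball⟩ := Metric.mem_nhds_iff.1 hmem
  refine ⟨δ / 2, half_pos hδ, hball ?_, hball ?_⟩ <;>
    simp [abs_of_pos hδ, hδ]

/-- If `A` is indecomposable, `D` is a `±1`-diagonal matrix with `DAD`
nonnegative, and `A` leaves invariant a proper cone `K ⊆ ℝ₊ⁿ`, then `D = ±I` and `A` itself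
is nonnegative. -/
theorem stmt_7 {n : ℕ} (hn : 2 ≤ n) (A : Matrix (Fin n) (Fin n) ℝ)
    (hind : ¬ Decomposable A)
    (d : Fin n → ℝ) (hd : ∀ i, d i = 1 ∨ d i = -1)
    (hDAD : ∀ i j, 0 ≤ (diagonal d * A * diagonal d) i j)
    (K : Set (Fin n → ℝ)) (hK : IsProperCone K)
    (hKpos : ∀ x ∈ K, ∀ i, 0 ≤ x i)
    (hKinv : ∀ x ∈ K, A.mulVec x ∈ K) :
    ((∀ i, d i = 1) ∨ (∀ i, d i = -1)) ∧ ∀ i j, 0 ≤ A i j := by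
  have hdd : ∀ i, d i * d i = 1 := fun i => by rcases hd i with h | h <;> simp [h]
  have hentry : ∀ i j, 0 ≤ d i * A i j * d j := by simpa using hDAD
  suffices hsign : (∀ i, d i = 1) ∨ (∀ i, d i = -1) by
    refine ⟨hsign, fun i j => ?_⟩
    rcases hsign with h | h <;> simpa [h] using hentry i j
  set B := diagonal d * A * diagonal d with hB
  have hBind : ¬ Decomposable B := by
    rintro ⟨σ, k, hk, hkn, h⟩
    refine hind ⟨σ, k, hk, hkn, fun i j hi hj => ?_⟩
    have hd0 : ∀ i, d i ≠ 0 := fun i h0 => by simpa [h0] using hdd i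
    simpa [hB, hd0] using h i j hi hj
  obtain ⟨N, hN⟩ := exists_one_add_pow_pos hDAD hBind
  obtain ⟨-, hadd, -, -, -, x, hx⟩ := hK
  obtain ⟨ε, hε, hplus, hminus⟩ := exists_pos_add_sub_smul_mem hx d
  have hDD : diagonal d * diagonal d = 1 := by simp [diagonal_mul_diagonal, hdd]
  have hconj : ∀ k : ℕ, (1 + B) ^ k * diagonal d = diagonal d * (1 + A) ^ k := fun k => by
    refine (SemiconjBy.pow_right (a := diagonal d) (x := 1 + A) (y := 1 + B) ?_ k).eq.symm
    rw [SemiconjBy, hB, mul_add, add_mul, mul_assoc (diagonal d * A), hDD]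
    simp
  have hpat : ∀ y ∈ K, ∀ k i, 0 ≤ d i * (((1 + B) ^ N) ^ k *ᵥ (diagonal d *ᵥ y)) i := by
    intro y hy k i
    rw [← pow_mul, mulVec_mulVec, hconj, ← mulVec_mulVec, mulVec_diagonal, ← mul_assoc, hdd,
      one_mul]
    exact hKpos _ (one_add_pow_mulVec_mem hadd hKinv _ hy) i
  have hDd : diagonal d *ᵥ d = 1 := funext fun i => by simp [mulVec_diagonal, hdd]
  have : Nonempty (Fin n) := ⟨⟨0, by omega⟩⟩
  obtain ⟨k, α, β, hαβ, h⟩ := exists_pow_ratio_bounds hN (diagonal d *ᵥ x) (mul_pos two_pos hε)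
  by_contra! hmixed
  obtain ⟨⟨j, hj⟩, i, hi⟩ := hmixed
  replace hi := (hd i).resolve_right hi
  replace hj := (hd j).resolve_left hj
  have hpi := hpat _ hminus k i
  have hpj := hpat _ hplus k j
  simp only [mulVec_add, mulVec_smul, hDd, hi, hj, Pi.add_apply, Pi.smul_apply, smul_eq_mul]
    at hpi hpj
  have hβ : ε ≤ β := le_of_mul_le_mul_right (by linarith [(h i).2.2]) (h i).1
  have hα : α ≤ -ε := le_of_mul_le_mul_right (by linarith [(h j).2.1]) (h j).1
  linarith
end

section
/- Let n ≥ 2, let a = (1,1,…,1,1−n)ᵀ ∈ ℝ^n, let A = a aᵀ ∈ M_n(ℝ), and let K = ℝ₊·(1,1,…,1)ᵀ be the ray generated by the all-ones vector. Then A is indecomposable, K ⊆ ℝ₊^n is a closed cone with A(K) ⊆ K, and D A D has all entries nonnegative for the diagonal matrix D with diagonal (1,1,…,1,−1); yet A itself has some strictly negative entries. (Hence the assumption that the invariant cone be solid cannot be omitted from the preceding lemma.) -/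
open Matrix

/-- The vector `(1,…,1,1−n)` has coordinate sum zero. -/
theorem sum_ite_last_eq_zero {n : ℕ} (hn : 0 < n) :
    ∑ i : Fin n, (if (i : ℕ) = n - 1 then 1 - (n : ℝ) else 1) = 0 := by
  obtain ⟨m, rfl⟩ : ∃ m, n = m + 1 := ⟨n - 1, by omega⟩
  rw [Fin.sum_univ_castSucc]
  have h (i : Fin m) : (i : ℕ) ≠ m := i.isLt.ne
  simp [h]

/-- A rank-one matrix `aaᵀ` with no zero entry in `a` is not decomposable. -/
theorem not_decomposable_vecMulVec {n : ℕ} {a : Fin n → ℝ} (ha : ∀ i, a i ≠ 0) :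
    ¬ Decomposable (vecMulVec a a) := by
  rintro ⟨σ, k, hk, hkn, h⟩
  exact mul_ne_zero (ha _) (ha _) (h ⟨k, hkn⟩ ⟨0, by omega⟩ le_rfl hk)

/-- The ray generated by the all-ones vector is closed. -/
theorem isClosed_ray_ones {n : ℕ} (hn : 0 < n) :
    IsClosed {v : Fin n → ℝ | ∃ r : ℝ, 0 ≤ r ∧ v = fun _ => r} := by
  have h : {v : Fin n → ℝ | ∃ r : ℝ, 0 ≤ r ∧ v = fun _ => r} =
      {v | 0 ≤ v ⟨0, hn⟩} ∩ {v | v = fun _ => v ⟨0, hn⟩} := by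
    ext v
    constructor
    · rintro ⟨r, hr, rfl⟩
      exact ⟨hr, rfl⟩
    · rintro ⟨h0, hv⟩
      exact ⟨_, h0, hv⟩
  rw [h]
  exact (isClosed_le (by fun_prop) (by fun_prop)).inter (isClosed_eq (by fun_prop) (by fun_prop))

/-- With `a = (1,…,1,1−n)ᵀ`, `A = aaᵀ` and `K = ℝ₊·(1,…,1)ᵀ`: `A` is
indecomposable, `K ⊆ ℝ₊ⁿ` is a closed cone invariant under `A`, and `DAD ≥ 0` for the
`±1`-diagonal matrix `D = diag(1,…,1,−1)`, yet `A` has strictly negative entries. -/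
theorem stmt_8 {n : ℕ} (hn : 2 ≤ n)
    (a : Fin n → ℝ) (ha : a = fun i : Fin n => if (i : ℕ) = n - 1 then 1 - (n : ℝ) else 1)
    (A : Matrix (Fin n) (Fin n) ℝ) (hA : A = vecMulVec a a)
    (K : Set (Fin n → ℝ)) (hK : K = {v | ∃ r : ℝ, 0 ≤ r ∧ v = fun _ => r})
    (d : Fin n → ℝ) (hd : d = fun i : Fin n => if (i : ℕ) = n - 1 then (-1 : ℝ) else 1) :
    ¬ Decomposable A ∧
    (∀ v ∈ K, ∀ i, 0 ≤ v i) ∧ IsClosed K ∧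
    (0 : Fin n → ℝ) ∈ K ∧ (∀ v ∈ K, ∀ w ∈ K, v + w ∈ K) ∧
    (∀ r : ℝ, 0 ≤ r → ∀ v ∈ K, r • v ∈ K) ∧
    (∀ v ∈ K, A.mulVec v ∈ K) ∧
    (∀ i j, 0 ≤ (diagonal d * A * diagonal d) i j) ∧
    (∃ i j, A i j < 0) := by
  have hn' : (2 : ℝ) ≤ n := by exact_mod_cast hn
  have hsum : ∑ i, a i = 0 := by
    rw [ha]
    exact sum_ite_last_eq_zero (by omega)
  have hane (i : Fin n) : a i ≠ 0 := by
    rw [ha]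
    dsimp only
    split_ifs <;> linarith
  have hda (i : Fin n) : 0 ≤ d i * a i := by
    rw [ha, hd]
    dsimp only
    split_ifs <;> linarith
  subst hA hK
  refine ⟨not_decomposable_vecMulVec hane, ?_, isClosed_ray_ones (by omega),
    ⟨0, le_rfl, rfl⟩, ?_, ?_, ?_, ?_, ?_⟩
  · rintro v ⟨r, hr, rfl⟩ i
    exact hr
  · rintro v ⟨r, hr, rfl⟩ w ⟨s, hs, rfl⟩
    exact ⟨r + s, add_nonneg hr hs, rfl⟩
  · rintro s hs v ⟨r, hr, rfl⟩
    exact ⟨s * r, mul_nonneg hs hr, rfl⟩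
  · rintro v ⟨r, hr, rfl⟩
    refine ⟨0, le_rfl, ?_⟩
    ext i
    simp only [mulVec, dotProduct, vecMulVec_apply]
    rw [← Finset.sum_mul, ← Finset.mul_sum, hsum, mul_zero, zero_mul]
  · intro i j
    rw [mul_diagonal, diagonal_mul, vecMulVec_apply]
    linarith [mul_nonneg (hda i) (hda j)]
  · refine ⟨⟨0, by omega⟩, ⟨n - 1, by omega⟩, ?_⟩
    have h0 : 0 ≠ n - 1 := by omega
    simp only [ha, vecMulVec_apply, if_neg h0, if_true]
    linarith
end
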